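/- arXiv:1702.01980 — 2 statements merged into one kernel-verified Lean document; each statement's English description precedes it below -/
import Mathlib

section
/- At the critical parameter λ = λ_c there is lack of compactness: there exist a sequence ε_k → 0 and maps m_k ∈ H¹(𝕋²; S²) such that F_{ε_k,λ_c}[m_k] → 0 as k → ∞, but no subsequence of (m_k) converges in L¹(𝕋²; ℝ³). -/
open MeasureTheory Real Filter

noncomputable section

/-- The plane `ℝ²`, modeled as functions `Fin 2 → ℝ`. -/
abbrev R2 : Type := Fin 2 → ℝ

/-- The target space `ℝ³`. -/
abbrev R3 : Type := Fin 3 → ℝ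

/-- A fundamental domain for the unit torus `𝕋² = ℝ²/ℤ²`. -/
def cube : Set R2 := Set.univ.pi fun _ => Set.Ico (0 : ℝ) 1

/-- The Euclidean norm on `ℝ²`. -/
def en2 (z : R2) : ℝ := Real.sqrt (∑ i, z i ^ 2)

/-- The Euclidean norm on `ℝ³`. -/
def en3 (v : R3) : ℝ := Real.sqrt (∑ i, v i ^ 2)

/-- `|∇f(x)|²` for a scalar function. -/
def gradNormSq (f : R2 → ℝ) (x : R2) : ℝ :=
  ∑ j, (fderiv ℝ f x (Pi.single j 1)) ^ 2

/-- `|∇f(x)|` for a scalar function. -/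
def gradNorm (f : R2 → ℝ) (x : R2) : ℝ := Real.sqrt (gradNormSq f x)

/-- `|∇m(x)|²` for a map `m : ℝ² → ℝ³` (Frobenius norm squared). -/
def gradVSq (m : R2 → R3) (x : R2) : ℝ :=
  ∑ j, ∑ i, (fderiv ℝ m x (Pi.single j 1) i) ^ 2

/-- The squared homogeneous `H^{1/2}` seminorm on the torus (real-space formula). -/
def H12 (f : R2 → ℝ) : ℝ :=
  (1 / (4 * π)) * ∫ x in cube, ∫ z : R2, (f (x + z) - f x) ^ 2 / en2 z ^ 3

/-- A (strong) magnetization in `H¹(𝕋²; S²)`: a continuously differentiable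
`ℤ²`-periodic map with values in the unit sphere `S² ⊂ ℝ³`. -/
def Mag (m : R2 → R3) : Prop :=
  ContDiff ℝ 1 m ∧
    (∀ (x : R2) (n : Fin 2 → ℤ), m (x + fun i => (n i : ℝ)) = m x) ∧
    ∀ x, ∑ i, (m x i) ^ 2 = 1

/-- The reduced thin-film energy `F_{ε,λ}`. -/
def Fen (ε lam : ℝ) (m : R2 → R3) : ℝ :=
  (∫ x in cube, (ε / 2 * gradVSq m x + (1 - (m x 2) ^ 2) / (2 * ε)))
    - lam / |Real.log ε| * H12 (fun x => m x 2)

/-- The north pole `e₃ = (0,0,1)`. -/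
def e3 : R3 := ![0, 0, 1]

def fT (c t : ℝ) : ℝ := Real.sinh (c * Real.cos (2 * π * t)) / Real.cosh (c * Real.cos (2 * π * t))

def sT (c t : ℝ) : ℝ := 1 / Real.cosh (c * Real.cos (2 * π * t))

lemma sT_sq (c t : ℝ) : sT c t ^ 2 = 1 - fT c t ^ 2 := by
  unfold sT fT
  have h := Real.cosh_pos (c * Real.cos (2 * π * t))
  have h2 := Real.cosh_sq (c * Real.cos (2 * π * t))
  rw [div_pow, div_pow, eq_sub_iff_add_eq, ← add_div, h2]
  rw [div_eq_one_iff_eq]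
  · ring
  · positivity

lemma abs_fT_le (c t : ℝ) : |fT c t| ≤ 1 := by
  have h := sT_sq c t
  rw [← sq_le_one_iff_abs_le_one]
  nlinarith [sq_nonneg (sT c t)]

lemma hasDeriv_u (c t : ℝ) :
    HasDerivAt (fun t => c * Real.cos (2 * π * t)) (-(2 * π * c * Real.sin (2 * π * t))) t := by
  have h1 : HasDerivAt (fun t : ℝ => 2 * π * t) (2 * π) t := by
    simpa using (hasDerivAt_id t).const_mul (2 * π)
  refine (h1.cos.const_mul c).congr_deriv ?_
  ring

lemma hasDeriv_fT (c t : ℝ) :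
    HasDerivAt (fT c) (-(2 * π * c * Real.sin (2 * π * t)) * sT c t ^ 2) t := by
  have hu := hasDeriv_u c t
  have h := Real.cosh_pos (c * Real.cos (2 * π * t))
  have h2 := Real.cosh_sq (c * Real.cos (2 * π * t))
  have := hu.sinh.div hu.cosh h.ne'
  refine this.congr_deriv ?_
  unfold sT
  field_simp
  rw [h2]; ring

lemma hasDeriv_sT (c t : ℝ) :
    HasDerivAt (sT c) ((2 * π * c * Real.sin (2 * π * t)) * (fT c t * sT c t)) t := by
  have hu := hasDeriv_u c t
  have h := Real.cosh_pos (c * Real.cos (2 * π * t))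
  have := (hasDerivAt_const t (1 : ℝ)).div hu.cosh h.ne'
  refine this.congr_deriv ?_
  unfold sT fT
  field_simp
  ring

lemma contDiff_fT (c : ℝ) : ContDiff ℝ 1 (fT c) := by
  unfold fT
  refine ContDiff.div ?_ ?_ (fun t => (Real.cosh_pos _).ne')
  · fun_prop
  · fun_prop

lemma contDiff_sT (c : ℝ) : ContDiff ℝ 1 (sT c) := by
  unfold sT
  refine ContDiff.div ?_ ?_ (fun t => (Real.cosh_pos _).ne')
  · fun_prop
  · fun_prop

lemma cont_fT (c : ℝ) : Continuous (fT c) := (contDiff_fT c).continuous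
lemma cont_sT (c : ℝ) : Continuous (sT c) := (contDiff_sT c).continuous

lemma cos_per (t : ℝ) (n : ℤ) : Real.cos (2 * π * (t + n)) = Real.cos (2 * π * t) := by
  rw [show 2 * π * (t + n) = 2 * π * t + n * (2 * π) by ring, Real.cos_add_int_mul_two_pi]

lemma fT_per (c t : ℝ) (n : ℤ) : fT c (t + n) = fT c t := by
  unfold fT; rw [cos_per]

lemma sT_per (c t : ℝ) (n : ℤ) : sT c (t + n) = sT c t := by
  unfold sT; rw [cos_per]

lemma fT_per1 (c : ℝ) : Function.Periodic (fT c) 1 := fun t => by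
  simpa using fT_per c t 1

lemma sT_per1 (c : ℝ) : Function.Periodic (sT c) 1 := fun t => by
  simpa using sT_per c t 1

lemma fT_half (c t : ℝ) : fT c (t + 1 / 2) = - fT c t := by
  unfold fT
  rw [show 2 * π * (t + 1 / 2) = 2 * π * t + π by ring, Real.cos_add_pi]
  simp [neg_div]

lemma fT_nonneg {c t : ℝ} (hc : 0 < c) (h : 0 ≤ Real.cos (2 * π * t)) : 0 ≤ fT c t := by
  unfold fT
  have := Real.cosh_pos (c * Real.cos (2 * π * t))
  have : 0 ≤ Real.sinh (c * Real.cos (2 * π * t)) := Real.sinh_nonneg_iff.2 (by positivity)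
  positivity

lemma fT_nonpos {c t : ℝ} (hc : 0 < c) (h : Real.cos (2 * π * t) ≤ 0) : fT c t ≤ 0 := by
  unfold fT
  have h1 := Real.cosh_pos (c * Real.cos (2 * π * t))
  have : Real.sinh (c * Real.cos (2 * π * t)) ≤ 0 :=
    Real.sinh_nonpos_iff.2 (mul_nonpos_of_nonneg_of_nonpos hc.le h)
  exact div_nonpos_of_nonpos_of_nonneg this h1.le

lemma sech_bound (u : ℝ) : (1 / Real.cosh u) ^ 2 * (1 + u ^ 2) ≤ 1 := by
  have h := Real.cosh_pos u
  have h2 := Real.cosh_sq u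
  have h3 : u ^ 2 ≤ Real.sinh u ^ 2 := by
    rw [sq_le_sq, Real.abs_sinh]
    exact Real.self_le_sinh_iff.2 (abs_nonneg u)
  rw [div_pow, one_pow, div_mul_eq_mul_div, one_mul, div_le_one (by positivity), h2]
  linarith

/-- the modulus of the derivative -/
def vT (c t : ℝ) : ℝ := 2 * π * c * |Real.sin (2 * π * t)| * sT c t ^ 2

lemma cont_vT (c : ℝ) : Continuous (vT c) := by
  have := cont_sT c
  unfold vT; fun_prop

lemma vT_per1 (c : ℝ) : Function.Periodic (vT c) 1 := fun t => by
  unfold vT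
  rw [sT_per1 c t, show 2 * π * (t + 1) = 2 * π * t + 2 * π by ring, Real.sin_add_two_pi]

def tc (c : ℝ) : ℝ := Real.sinh c / Real.cosh c

lemma fT_zero (c : ℝ) : fT c 0 = tc c := by simp [fT, tc]
lemma fT_one (c : ℝ) : fT c 1 = tc c := by rw [← fT_zero, ← fT_per1 c 0]; simp
lemma fT_h (c : ℝ) : fT c (1/2) = - tc c := by rw [← fT_zero, ← fT_half c 0]; simp

lemma cont_dfT (c : ℝ) : Continuous (fun t => -(2 * π * c * Real.sin (2 * π * t)) * sT c t ^ 2) := by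
  have := cont_sT c
  fun_prop

lemma int_vT (c : ℝ) : ∫ t in (0 : ℝ)..1, vT c t = 4 * tc c := by
  have hI : ∀ a b, IntervalIntegrable (vT c) volume a b := fun a b => (cont_vT c).intervalIntegrable a b
  rw [← intervalIntegral.integral_add_adjacent_intervals (hI 0 (1/2)) (hI (1/2) 1)]
  have h1 : ∫ t in (0 : ℝ)..(1/2), vT c t = - (fT c (1/2) - fT c 0) := by
    rw [← intervalIntegral.integral_eq_sub_of_hasDerivAt (fun t _ => hasDeriv_fT c t)
      ((cont_dfT c).intervalIntegrable _ _), ← intervalIntegral.integral_neg]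
    apply intervalIntegral.integral_congr
    intro t ht
    rw [Set.uIcc_of_le (by norm_num)] at ht
    have : 0 ≤ Real.sin (2 * π * t) := by
      apply Real.sin_nonneg_of_nonneg_of_le_pi
      · have := ht.1; positivity
      · nlinarith [ht.2, Real.pi_pos]
    simp only [vT, abs_of_nonneg this]; ring
  have h2 : ∫ t in (1/2 : ℝ)..1, vT c t = (fT c 1 - fT c (1/2)) := by
    rw [← intervalIntegral.integral_eq_sub_of_hasDerivAt (fun t _ => hasDeriv_fT c t)
      ((cont_dfT c).intervalIntegrable _ _)]
    apply intervalIntegral.integral_congr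
    intro t ht
    rw [Set.uIcc_of_le (by norm_num)] at ht
    have : Real.sin (2 * π * t) ≤ 0 := by
      have : 0 ≤ Real.sin (2 * π * t - π) := by
        apply Real.sin_nonneg_of_nonneg_of_le_pi
        · nlinarith [ht.1, Real.pi_pos]
        · nlinarith [ht.2, Real.pi_pos]
      rw [Real.sin_sub_pi] at this
      linarith
    simp only [vT, abs_of_nonpos this]; ring
  rw [h1, h2, fT_zero, fT_one, fT_h]; ring

def JT (c : ℝ) : ℝ := ∫ t in (0 : ℝ)..1, sT c t ^ 2 * (1 + Real.sin (2 * π * t) ^ 2)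

lemma cont_J (c : ℝ) : Continuous (fun t => sT c t ^ 2 * (1 + Real.sin (2 * π * t) ^ 2)) := by
  have := cont_sT c
  fun_prop

lemma J_lower {c : ℝ} (hc : 0 < c) : 4 * tc c ≤ π * c * JT c := by
  rw [← int_vT, JT, ← intervalIntegral.integral_const_mul]
  apply intervalIntegral.integral_mono_on (by norm_num) ((cont_vT c).intervalIntegrable _ _)
    (((cont_J c).const_smul (π * c)).intervalIntegrable _ _)
  intro t _
  simp only [vT, Pi.smul_apply, Pi.add_apply, smul_eq_mul]
  have h1 := sq_abs (Real.sin (2 * π * t))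
  rw [← h1]
  have : 0 ≤ π * c * sT c t ^ 2 * (1 - |Real.sin (2 * π * t)|) ^ 2 := by positivity
  nlinarith

lemma J_upper {c : ℝ} (hc : 0 < c) : π * c * JT c ≤ 4 * tc c + π / c := by
  have : ∫ t in (0 : ℝ)..1, π / c = π / c := by simp
  rw [← int_vT, JT, ← intervalIntegral.integral_const_mul, ← this,
    ← intervalIntegral.integral_add ((cont_vT c).intervalIntegrable _ _) (by simp)]
  apply intervalIntegral.integral_mono_on (by norm_num)
    (((cont_J c).const_smul (π * c)).intervalIntegrable _ _)
    (((cont_vT c).add continuous_const).intervalIntegrable _ _)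
  intro t _
  simp only [vT, Pi.smul_apply, Pi.add_apply, smul_eq_mul]
  set q := |Real.sin (2 * π * t)| with hq
  have hq0 : 0 ≤ q := abs_nonneg _
  have hq1 : q ≤ 1 := Real.abs_sin_le_one _
  have h1 : q ^ 2 = Real.sin (2 * π * t) ^ 2 := sq_abs _
  rw [← h1]
  set d := Real.cos (2 * π * t) with hd
  have hcs : q ^ 2 + d ^ 2 = 1 := by rw [h1]; exact Real.sin_sq_add_cos_sq _
  have hb := sech_bound (c * d)
  have hs : sT c t ^ 2 = (1 / Real.cosh (c * d)) ^ 2 := rfl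
  rw [← hs] at hb
  have hs0 : 0 ≤ sT c t ^ 2 := sq_nonneg _
  set s := sT c t ^ 2
  -- s * (1-q)^2 ≤ s d^2 ≤ 1/c^2
  have h3 : (1 - q) ^ 2 ≤ d ^ 2 := by nlinarith
  have h4 : c ^ 2 * (s * (1 - q) ^ 2) ≤ 1 := by
    have : c ^ 2 * (s * (1 - q) ^ 2) ≤ c ^ 2 * (s * d ^ 2) := by gcongr
    nlinarith
  have h5 : π * c * (s * (1 - q) ^ 2) ≤ π / c := by
    rw [le_div_iff₀ hc]
    nlinarith [Real.pi_pos]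
  nlinarith

lemma tc_le_one (c : ℝ) : tc c ≤ 1 := by
  rw [← fT_zero]; exact (abs_le.1 (abs_fT_le c 0)).2

lemma tc_lower {c : ℝ} (hc : 0 < c) : 1 - 1 / c ≤ tc c := by
  have h0 : 0 ≤ tc c := by
    rw [← fT_zero]; exact fT_nonneg hc (by simp)
  have h := sT_sq c 0
  rw [fT_zero] at h
  have hb := sech_bound c
  have hs : sT c 0 ^ 2 = (1 / Real.cosh c) ^ 2 := by simp [sT]
  rw [← hs] at hb
  have h1 := tc_le_one c
  have : 1 - tc c ≤ sT c 0 ^ 2 := by rw [h]; nlinarith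
  have h2 : c * sT c 0 ^ 2 ≤ 1 := by
    nlinarith [sq_nonneg (sT c 0), mul_nonneg (sq_nonneg (sT c 0)) (sq_nonneg (c - 1))]
  have : c * sT c 0 ^ 2 / c ≤ 1 / c := by gcongr
  rw [mul_div_cancel_left₀ _ hc.ne'] at this
  linarith

lemma int_s_le {c : ℝ} (hc : 1 ≤ c) : ∫ t in (0 : ℝ)..1, sT c t ^ 2 ≤ 3 / c := by
  have h0 : 0 < c := by linarith
  have h : ∫ t in (0 : ℝ)..1, sT c t ^ 2 ≤ JT c := by
    apply intervalIntegral.integral_mono_on (by norm_num) (((cont_sT c).pow 2).intervalIntegrable _ _)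
      ((cont_J c).intervalIntegrable _ _)
    intro t _
    simp only [Pi.pow_apply]
    nlinarith [mul_nonneg (sq_nonneg (sT c t)) (sq_nonneg (Real.sin (2 * π * t)))]
  have h2 := J_upper h0
  have h3 := tc_le_one c
  have h4 : π / c ≤ π := div_le_self Real.pi_pos.le hc
  refine h.trans ?_
  rw [le_div_iff₀ h0]
  have := Real.pi_gt_three
  by_contra hcon
  push Not at hcon
  nlinarith

def AT (c z : ℝ) : ℝ := ∫ x in (0 : ℝ)..1, (fT c (x + z) - fT c x) ^ 2

lemma cont_diff_sq (c z : ℝ) : Continuous (fun x => (fT c (x + z) - fT c x) ^ 2) := by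
  have := cont_fT c
  fun_prop

lemma AT_nonneg (c z : ℝ) : 0 ≤ AT c z :=
  intervalIntegral.integral_nonneg (by norm_num) (fun _ _ => sq_nonneg _)

lemma diff_sq_le_four (c x y : ℝ) : (fT c y - fT c x) ^ 2 ≤ 4 := by
  have h1 := abs_le.1 (abs_fT_le c x)
  have h2 := abs_le.1 (abs_fT_le c y)
  nlinarith

lemma AT_le_four (c z : ℝ) : AT c z ≤ 4 := by
  have : ∫ t in (0 : ℝ)..1, (4 : ℝ) = 4 := by simp
  rw [← this]
  apply intervalIntegral.integral_mono_on (by norm_num)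
    ((cont_diff_sq c z).intervalIntegrable _ _) (by simp)
  intro x _
  exact diff_sq_le_four _ _ _

lemma per_int {g : ℝ → ℝ} (hg : Function.Periodic g 1) (a : ℝ) :
    ∫ x in a..(a + 1), g x = ∫ x in (0 : ℝ)..1, g x := by
  have := hg.intervalIntegral_add_eq a 0
  simpa using this

lemma per_int_shift {g : ℝ → ℝ} (hg : Function.Periodic g 1) (a : ℝ) :
    ∫ x in (0 : ℝ)..1, g (x + a) = ∫ x in (0 : ℝ)..1, g x := by
  rw [intervalIntegral.integral_comp_add_right (fun x => g x), ← per_int hg a]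
  congr 1 <;> ring

lemma per_int_scale {g : ℝ → ℝ} (hg : Function.Periodic g 1) (hc : Continuous g) {n : ℕ} (hn : 0 < n) :
    ∫ x in (0 : ℝ)..1, g (n * x) = ∫ x in (0 : ℝ)..1, g x := by
  have hn' : (n : ℝ) ≠ 0 := by positivity
  rw [intervalIntegral.integral_comp_mul_left (fun x => g x) hn']
  have := hg.intervalIntegral_add_zsmul_eq n 0 (fun a b => hc.intervalIntegrable a b)
  simp at this
  simp [this]
  field_simp

lemma AT_neg (c z : ℝ) : AT c (-z) = AT c z := by
  unfold AT
  have hp : Function.Periodic (fun x => (fT c (x + -z) - fT c x) ^ 2) 1 := fun x => by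
    simp only
    rw [show x + 1 + -z = (x + -z) + 1 by ring, fT_per1 c x, fT_per1 c (x + -z)]
  rw [← per_int_shift hp z]
  congr 1; ext x; simp only [add_neg_cancel_right]; ring

lemma AT_abs (c z : ℝ) : AT c |z| = AT c z := by
  rcases abs_cases z with h | h
  · rw [h.1]
  · rw [h.1, AT_neg]

lemma abs_deriv (c t : ℝ) (hc : 0 < c) :
    ‖-(2 * π * c * Real.sin (2 * π * t)) * sT c t ^ 2‖ = vT c t := by
  unfold vT
  rw [norm_mul, norm_neg, norm_mul, Real.norm_eq_abs, Real.norm_eq_abs, Real.norm_eq_abs,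
    abs_of_nonneg (sq_nonneg (sT c t)), abs_of_pos (by positivity)]

lemma vT_le (c t : ℝ) (hc : 0 < c) : vT c t ≤ 2 * π * c := by
  unfold vT
  have h1 : |Real.sin (2 * π * t)| ≤ 1 := Real.abs_sin_le_one _
  have h2 : sT c t ^ 2 ≤ 1 := by rw [sT_sq]; nlinarith [sq_nonneg (fT c t)]
  calc 2 * π * c * |Real.sin (2 * π * t)| * sT c t ^ 2 ≤ 2 * π * c * 1 * 1 := by gcongr
    _ = _ := by ring

lemma diff_le (c x z : ℝ) (hc : 0 < c) (hz : 0 ≤ z) :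
    |fT c (x + z) - fT c x| ≤ ∫ s in (0 : ℝ)..z, vT c (x + s) := by
  rw [← intervalIntegral.integral_eq_sub_of_hasDerivAt (fun t _ => hasDeriv_fT c t)
      ((cont_dfT c).intervalIntegrable _ _)]
  have h := intervalIntegral.norm_integral_le_integral_norm (μ := volume)
    (f := fun t => -(2 * π * c * Real.sin (2 * π * t)) * sT c t ^ 2) (a := x) (b := x + z) (by linarith)
  simp only [abs_deriv c _ hc] at h
  refine h.trans (le_of_eq ?_)
  rw [intervalIntegral.integral_comp_add_left (fun t => vT c t)]
  simp

lemma diff_lip (c x z : ℝ) (hc : 0 < c) (hz : 0 ≤ z) :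
    |fT c (x + z) - fT c x| ≤ 2 * π * c * z := by
  refine (diff_le c x z hc hz).trans ?_
  have : ∫ s in (0 : ℝ)..z, (2 * π * c) = 2 * π * c * z := by simp; ring
  rw [← this]
  have := cont_vT c
  apply intervalIntegral.integral_mono_on hz
    ((show Continuous (fun s => vT c (x + s)) by fun_prop).intervalIntegrable _ _) (by simp)
  intro s _; exact vT_le c _ hc

lemma int_diff_le (c z : ℝ) (hc : 0 < c) (hz : 0 ≤ z) :
    ∫ x in (0 : ℝ)..1, |fT c (x + z) - fT c x| ≤ 4 * z := by
  have hv := cont_vT c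
  have hf := cont_fT c
  have hcont2 : Continuous (Function.uncurry fun x s => vT c (x + s)) := by
    unfold Function.uncurry; fun_prop
  have h1 : ∫ x in (0 : ℝ)..1, |fT c (x + z) - fT c x| ≤
      ∫ x in (0 : ℝ)..1, ∫ s in (0 : ℝ)..z, vT c (x + s) := by
    apply intervalIntegral.integral_mono_on (by norm_num)
      ((show Continuous (fun x => |fT c (x + z) - fT c x|) by fun_prop).intervalIntegrable _ _)
    · apply Continuous.intervalIntegrable
      exact intervalIntegral.continuous_parametric_intervalIntegral_of_continuous' hcont2 _ _
    · intro x _; exact diff_le c x z hc hz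
  refine h1.trans ?_
  rw [intervalIntegral_intervalIntegral_swap]
  · have : ∀ s, ∫ x in (0 : ℝ)..1, vT c (x + s) = 4 * tc c := fun s => by
      rw [per_int_shift (vT_per1 c), int_vT]
    simp only [this]
    simp
    have := tc_le_one c
    nlinarith
  · apply IntegrableOn.mono_set (t := Set.Icc (0 : ℝ) 1 ×ˢ Set.Icc 0 z)
    · exact hcont2.continuousOn.integrableOn_compact (isCompact_Icc.prod isCompact_Icc)
    · rw [Set.uIoc_of_le (by norm_num), Set.uIoc_of_le hz]
      exact Set.prod_mono Set.Ioc_subset_Icc_self Set.Ioc_subset_Icc_self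

lemma AT_le_lin (c z : ℝ) (hc : 0 < c) (hz : 0 ≤ z) : AT c z ≤ 8 * z := by
  have hf := cont_fT c
  have h := int_diff_le c z hc hz
  have : AT c z ≤ ∫ x in (0 : ℝ)..1, 2 * |fT c (x + z) - fT c x| := by
    apply intervalIntegral.integral_mono_on (by norm_num)
      ((cont_diff_sq c z).intervalIntegrable _ _)
      ((show Continuous (fun x => 2 * |fT c (x + z) - fT c x|) by fun_prop).intervalIntegrable _ _)
    intro x _
    have h1 := abs_le.1 (abs_fT_le c x)
    have h2 := abs_le.1 (abs_fT_le c (x + z))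
    have h3 : |fT c (x + z) - fT c x| ≤ 2 := by rw [abs_le]; constructor <;> linarith
    rw [← sq_abs]
    nlinarith [abs_nonneg (fT c (x + z) - fT c x)]
  rw [intervalIntegral.integral_const_mul] at this
  linarith

lemma AT_le_sq (c z : ℝ) (hc : 0 < c) (hz : 0 ≤ z) : AT c z ≤ 8 * π * c * z ^ 2 := by
  have hf := cont_fT c
  have h := int_diff_le c z hc hz
  have : AT c z ≤ ∫ x in (0 : ℝ)..1, (2 * π * c * z) * |fT c (x + z) - fT c x| := by
    apply intervalIntegral.integral_mono_on (by norm_num)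
      ((cont_diff_sq c z).intervalIntegrable _ _)
      ((show Continuous (fun x => (2 * π * c * z) * |fT c (x + z) - fT c x|) by fun_prop).intervalIntegrable _ _)
    intro x _
    have h3 := diff_lip c x z hc hz
    rw [← sq_abs]
    nlinarith [abs_nonneg (fT c (x + z) - fT c x)]
  rw [intervalIntegral.integral_const_mul] at this
  have h5 : (2 * π * c * z) * ∫ x in (0 : ℝ)..1, |fT c (x + z) - fT c x| ≤ (2 * π * c * z) * (4 * z) := by
    gcongr
  nlinarith

lemma jump_alg (a b : ℝ) (ha : 0 ≤ a) (ha1 : a ≤ 1) (hb : 0 ≤ b) (hb1 : b ≤ 1) :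
    4 ≤ (a + b) ^ 2 + 4 * (1 - a ^ 2) + 4 * (1 - b ^ 2) := by
  nlinarith [mul_nonneg ha (sub_nonneg.2 ha1), mul_nonneg hb (sub_nonneg.2 hb1), sq_nonneg (a + b - 2)]

lemma cos_nonneg_mid {t : ℝ} (h1 : -(1/4) ≤ t) (h2 : t ≤ 1/4) : 0 ≤ Real.cos (2 * π * t) := by
  apply Real.cos_nonneg_of_mem_Icc
  constructor <;> nlinarith [Real.pi_pos]

lemma cos_nonpos_mid {t : ℝ} (h1 : 1/4 ≤ t) (h2 : t ≤ 3/4) : Real.cos (2 * π * t) ≤ 0 := by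
  apply Real.cos_nonpos_of_pi_div_two_le_of_le <;> nlinarith [Real.pi_pos]

lemma cos_nonneg_mid' {t : ℝ} (h1 : 3/4 ≤ t) (h2 : t ≤ 5/4) : 0 ≤ Real.cos (2 * π * t) := by
  have := cos_per t (-1)
  rw [← this]
  apply cos_nonneg_mid <;> push_cast <;> linarith

lemma AT_lower (c z : ℝ) (hc : 1 ≤ c) (hz : 0 ≤ z) (hz2 : z ≤ 1/2) : 8 * z - 24 / c ≤ AT c z := by
  have hc0 : 0 < c := by linarith
  have hf := cont_fT c
  have hs := cont_sT c
  set h : ℝ → ℝ := fun x => (fT c (x + z) - fT c x) ^ 2 + 4 * sT c x ^ 2 + 4 * sT c (x + z) ^ 2 with hh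
  have hcont : Continuous h := by fun_prop
  have hI : ∀ a b, IntervalIntegrable h volume a b := fun a b => hcont.intervalIntegrable a b
  have hper : Function.Periodic h 1 := fun x => by
    simp only [hh]
    rw [show x + 1 + z = (x + z) + 1 by ring, fT_per1 c x, fT_per1 c (x + z), sT_per1 c x,
      sT_per1 c (x + z)]
  have hnn : ∀ x, 0 ≤ h x := fun x => by positivity
  have hint : ∫ x in (0 : ℝ)..1, h x = AT c z + 8 * ∫ x in (0 : ℝ)..1, sT c x ^ 2 := by
    simp only [hh]
    rw [intervalIntegral.integral_add, intervalIntegral.integral_add,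
      intervalIntegral.integral_const_mul, intervalIntegral.integral_const_mul,
      per_int_shift (g := fun x => sT c x ^ 2) (fun x => by simp only [sT_per1 c x]) z]
    · unfold AT; ring
    all_goals exact Continuous.intervalIntegrable (by fun_prop) _ _
  have hs3 := int_s_le hc
  have key : 8 * z ≤ ∫ x in (0 : ℝ)..1, h x := by
    rw [← per_int hper (-(1/4)), show (-(1/4) : ℝ) + 1 = 3/4 by norm_num,
      ← intervalIntegral.integral_add_adjacent_intervals (hI (-(1/4)) (1/4 - z)) (hI (1/4-z) (3/4)),
      ← intervalIntegral.integral_add_adjacent_intervals (hI (1/4 - z) (1/4)) (hI (1/4) (3/4)),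
      ← intervalIntegral.integral_add_adjacent_intervals (hI (1/4) (3/4 - z)) (hI (3/4-z) (3/4))]
    have e1 : 0 ≤ ∫ x in (-(1/4) : ℝ)..(1/4 - z), h x :=
      intervalIntegral.integral_nonneg (by linarith) (fun x _ => hnn x)
    have e2 : 0 ≤ ∫ x in (1/4 : ℝ)..(3/4 - z), h x :=
      intervalIntegral.integral_nonneg (by linarith) (fun x _ => hnn x)
    have e3 : 4 * z ≤ ∫ x in (1/4 - z : ℝ)..(1/4), h x := by
      have : ∫ x in (1/4 - z : ℝ)..(1/4), (4 : ℝ) = 4 * z := by simp; ring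
      rw [← this]
      apply intervalIntegral.integral_mono_on (by linarith) (by simp) (hI _ _)
      intro x hx
      have p1 := fT_nonneg hc0 (cos_nonneg_mid (t := x) (by linarith [hx.1]) hx.2)
      have p2 := fT_nonpos hc0 (cos_nonpos_mid (t := x + z) (by linarith [hx.1]) (by linarith [hx.2]))
      have q1 := abs_le.1 (abs_fT_le c x)
      have q2 := abs_le.1 (abs_fT_le c (x + z))
      simp only [hh, sT_sq]
      have := jump_alg (fT c x) (- fT c (x + z)) p1 q1.2 (by linarith) (by linarith)
      nlinarith
    have e4 : 4 * z ≤ ∫ x in (3/4 - z : ℝ)..(3/4), h x := by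
      have : ∫ x in (3/4 - z : ℝ)..(3/4), (4 : ℝ) = 4 * z := by simp; ring
      rw [← this]
      apply intervalIntegral.integral_mono_on (by linarith) (by simp) (hI _ _)
      intro x hx
      have p1 := fT_nonpos hc0 (cos_nonpos_mid (t := x) (by linarith [hx.1]) hx.2)
      have p2 := fT_nonneg hc0 (cos_nonneg_mid' (t := x + z) (by linarith [hx.1]) (by linarith [hx.2]))
      have q1 := abs_le.1 (abs_fT_le c x)
      have q2 := abs_le.1 (abs_fT_le c (x + z))
      simp only [hh, sT_sq]
      have := jump_alg (- fT c x) (fT c (x + z)) (by linarith) (by linarith) p2 q2.2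
      nlinarith
    linarith
  rw [hint] at key
  have : 24 / c = 8 * (3 / c) := by ring
  linarith

lemma hasDeriv_kernel (a t : ℝ) (ha : a ≠ 0) :
    HasDerivAt (fun t => t / Real.sqrt (a ^ 2 + t ^ 2) / a ^ 2) (1 / Real.sqrt (a ^ 2 + t ^ 2) ^ 3) t := by
  have hpos : 0 < a ^ 2 + t ^ 2 := by positivity
  have h1 : HasDerivAt (fun t : ℝ => a ^ 2 + t ^ 2) (2 * t) t := by
    simpa using (hasDerivAt_pow 2 t).const_add (a ^ 2)
  have h2 := h1.sqrt hpos.ne'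
  have h3 := ((hasDerivAt_id t).div h2 (Real.sqrt_pos.2 hpos).ne').div_const (a ^ 2)
  refine h3.congr_deriv ?_
  have hs := Real.sqrt_pos.2 hpos
  have hsq := Real.sq_sqrt hpos.le
  set r := Real.sqrt (a ^ 2 + t ^ 2)
  simp only [id]
  field_simp
  rw [hsq]; ring

lemma tendsto_kernel (a : ℝ) :
    Tendsto (fun t => t / Real.sqrt (a ^ 2 + t ^ 2) / a ^ 2) atTop (nhds (1 / a ^ 2)) := by
  apply Tendsto.div_const
  have h1 : Tendsto (fun t : ℝ => 1 / Real.sqrt (a ^ 2 * (t ^ 2)⁻¹ + 1)) atTop (nhds 1) := by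
    have h0 : Tendsto (fun t : ℝ => (t ^ 2)⁻¹) atTop (nhds 0) :=
      (tendsto_pow_atTop (by norm_num)).inv_tendsto_atTop
    have h2 : Tendsto (fun t : ℝ => Real.sqrt (a ^ 2 * (t ^ 2)⁻¹ + 1)) atTop (nhds (Real.sqrt (a ^ 2 * 0 + 1))) :=
      ((h0.const_mul (a ^ 2)).add_const 1).sqrt
    have h3 := h2.inv₀ (by simp)
    simpa using h3
  refine h1.congr' ?_
  filter_upwards [eventually_gt_atTop 0] with t ht
  rw [show a ^ 2 * (t ^ 2)⁻¹ + 1 = (a ^ 2 + t ^ 2) / t ^ 2 by field_simp,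
    Real.sqrt_div' _ (by positivity), Real.sqrt_sq ht.le, one_div_div]

lemma kernel_int (a : ℝ) (ha : a ≠ 0) : ∫ t, 1 / Real.sqrt (a ^ 2 + t ^ 2) ^ 3 = 2 / a ^ 2 := by
  have h := integral_comp_abs (f := fun t => 1 / Real.sqrt (a ^ 2 + t ^ 2) ^ 3)
  simp only [sq_abs] at h
  rw [h, integral_Ioi_of_hasDerivAt_of_nonneg' (fun t _ => hasDeriv_kernel a t ha)
    (fun t _ => by positivity) (tendsto_kernel a)]
  simp; ring

lemma kernel_lint (a : ℝ) (ha : a ≠ 0) :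
    ∫⁻ t, ENNReal.ofReal (1 / Real.sqrt (a ^ 2 + t ^ 2) ^ 3) = ENNReal.ofReal (2 / a ^ 2) := by
  rw [← kernel_int a ha, ofReal_integral_eq_lintegral_ofReal]
  · apply not_imp_comm.1 integral_undef
    rw [kernel_int a ha]; positivity
  · exact Eventually.of_forall (fun t => by positivity)

lemma en2_eq (z : R2) : en2 z = Real.sqrt (z 0 ^ 2 + z 1 ^ 2) := by simp [en2]

lemma inner_red (D : ℝ → ℝ) (hD : ∀ t, 0 ≤ D t) (hm : Measurable D) :
    ∫ z : R2, D (z 0) / en2 z ^ 3 = ∫ t, D t * (2 / t ^ 2) := by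
  have hmeas : Measurable (fun p : ℝ × ℝ => D p.1 / Real.sqrt (p.1 ^ 2 + p.2 ^ 2) ^ 3) := by fun_prop
  have e1 : ∫ z : R2, D (z 0) / en2 z ^ 3 =
      ∫ p : ℝ × ℝ, D p.1 / Real.sqrt (p.1 ^ 2 + p.2 ^ 2) ^ 3 := by
    rw [← (volume_preserving_finTwoArrow ℝ).integral_comp']
    simp only [en2_eq]
    rfl
  rw [e1, integral_eq_lintegral_of_nonneg_ae, integral_eq_lintegral_of_nonneg_ae]
  · congr 1
    rw [Measure.volume_eq_prod, lintegral_prod _ (by fun_prop)]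
    apply lintegral_congr_ae
    have : ∀ᵐ t : ℝ, t ≠ 0 := by simp [ae_iff]
    filter_upwards [this] with t ht
    rw [ENNReal.ofReal_mul (hD t), ← kernel_lint t ht, ← lintegral_const_mul _ (by fun_prop)]
    congr 1; ext y
    rw [← ENNReal.ofReal_mul (hD t)]
    congr 1; ring
  · exact Eventually.of_forall fun t => mul_nonneg (hD t) (by positivity)
  · exact Measurable.aestronglyMeasurable (by fun_prop)
  · exact Eventually.of_forall fun p => div_nonneg (hD _) (by positivity)
  · exact hmeas.aestronglyMeasurable

lemma cube_int (K : ℝ → ℝ) : ∫ x in cube, K (x 0) = ∫ t in (0 : ℝ)..1, K t := by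
  have hms : MeasurableSet cube := MeasurableSet.univ_pi (fun _ => measurableSet_Ico)
  rw [intervalIntegral.integral_of_le (by norm_num), ← integral_Ico_eq_integral_Ioc,
    ← integral_indicator hms, ← integral_indicator measurableSet_Ico]
  have := integral_fintype_prod_volume_eq_prod (𝕜 := ℝ) (ι := Fin 2) (E := fun _ => ℝ)
    ![(Set.Ico (0:ℝ) 1).indicator K, (Set.Ico (0:ℝ) 1).indicator 1]
  simp only [Fin.prod_univ_two, Matrix.cons_val_zero, Matrix.cons_val_one] at this
  rw [integral_indicator_one measurableSet_Ico] at this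
  simp at this
  rw [← this]
  congr 1; ext x
  by_cases h0 : x 0 ∈ Set.Ico (0:ℝ) 1 <;> by_cases h1 : x 1 ∈ Set.Ico (0:ℝ) 1
  · rw [Set.indicator_of_mem h0, Set.indicator_of_mem h1, Set.indicator_of_mem]
    · simp
    · intro i _; fin_cases i <;> assumption
  · rw [Set.indicator_of_notMem h1, Set.indicator_of_notMem]
    · simp
    · intro h; exact h1 (h 1 trivial)
  · rw [Set.indicator_of_notMem h0, Set.indicator_of_notMem]
    · simp
    · intro h; exact h0 (h 0 trivial)
  · rw [Set.indicator_of_notMem h0, Set.indicator_of_notMem]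
    · simp
    · intro h; exact h0 (h 0 trivial)

lemma diff_lip' (c x z : ℝ) (hc : 0 < c) :
    (fT c (x + z) - fT c x) ^ 2 ≤ (2 * π * c) ^ 2 * z ^ 2 := by
  rw [← mul_pow, sq_le_sq, abs_mul (2 * π * c), abs_of_pos (show 0 < 2 * π * c by positivity)]
  rcases le_total 0 z with h | h
  · rw [abs_of_nonneg h]; exact diff_lip c x z hc h
  · have := diff_lip c (x + z) (-z) hc (by linarith)
    rw [abs_of_nonpos h, abs_sub_comm]
    simpa using this

/-- dominating function -/
lemma dom_integrable (K : ℝ) : Integrable (fun z : ℝ => K * (1 + z ^ 2)⁻¹) :=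
  integrable_inv_one_add_sq.const_mul K

lemma dom_bound {d L z : ℝ} (h4 : d ≤ 4) (hL : 0 ≤ L) (hd : d ≤ L * z ^ 2) :
    d * (2 / z ^ 2) ≤ (2 * (L + 4)) * (1 + z ^ 2)⁻¹ := by
  by_cases hz : z = 0
  · subst hz; simp; positivity
  have hz2 : 0 < z ^ 2 := by positivity
  rw [← div_eq_mul_inv, mul_div_assoc', div_le_div_iff₀ hz2 (by positivity)]
  nlinarith [mul_le_mul_of_nonneg_right h4 hz2.le]

lemma H12_red (c : ℝ) (hc : 0 < c) (n : ℕ) (hn : 0 < n) :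
    H12 (fun x => fT c (n * x 0)) = 1 / π * ∫ z in Set.Ioi (0 : ℝ), AT c (n * z) / z ^ 2 := by
  have hf := cont_fT c
  have hfm := hf.measurable
  have e1 : ∀ x : R2, ∫ z : R2, (fT c (n * (x + z) 0) - fT c (n * x 0)) ^ 2 / en2 z ^ 3 =
      (fun x0 : ℝ => ∫ z : ℝ, (fT c (n * (x0 + z)) - fT c (n * x0)) ^ 2 * (2 / z ^ 2)) (x 0) := by
    intro x
    exact inner_red (fun z => (fT c (n * (x 0 + z)) - fT c (n * x 0)) ^ 2) (fun _ => sq_nonneg _)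
      (by fun_prop)
  unfold H12
  simp only [e1]
  rw [cube_int (fun x0 : ℝ => ∫ z : ℝ, (fT c (n * (x0 + z)) - fT c (n * x0)) ^ 2 * (2 / z ^ 2))]
  rw [intervalIntegral_integral_swap]
  · have e2 : ∀ z : ℝ, ∫ x in (0 : ℝ)..1, (fT c (n * (x + z)) - fT c (n * x)) ^ 2 * (2 / z ^ 2) =
        (fun z => AT c (n * z) * (2 / z ^ 2)) |z| := by
      intro z
      simp only [sq_abs]
      rw [intervalIntegral.integral_mul_const]
      congr 1
      rw [show (n : ℝ) * |z| = |n * z| by rw [abs_mul, Nat.abs_cast], AT_abs]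
      unfold AT
      rw [← per_int_scale (g := fun x => (fT c (x + n * z) - fT c x) ^ 2) _ (cont_diff_sq c _) hn]
      · congr 1; ext x; rw [mul_add]
      · intro x; simp only
        rw [show x + 1 + n * z = (x + n * z) + 1 by ring, fT_per1 c x, fT_per1 c (x + n * z)]
    simp only [e2]
    rw [integral_comp_abs (f := fun z => AT c (n * z) * (2 / z ^ 2))]
    have : ∀ z : ℝ, AT c (n * z) * (2 / z ^ 2) = 2 * (AT c (n * z) / z ^ 2) := fun z => by ring
    simp only [this]
    rw [integral_const_mul]
    field_simp; ring
  · rw [Set.uIoc_of_le zero_le_one]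
    have hd := (dom_integrable (2 * ((2 * π * c * n) ^ 2 + 4))).comp_snd (volume.restrict (Set.Ioc (0:ℝ) 1))
    refine hd.mono' ?_ ?_
    · apply Measurable.aestronglyMeasurable
      unfold Function.uncurry
      fun_prop
    · refine Eventually.of_forall fun p => ?_
      simp only [Function.uncurry]
      rw [Real.norm_of_nonneg (by positivity)]
      refine dom_bound (diff_sq_le_four _ _ _) (by positivity) ?_
      have := diff_lip' c (n * p.1) (n * p.2) hc
      rw [mul_add]
      refine this.trans (le_of_eq (by ring))

lemma cont_AT (c : ℝ) : Continuous (AT c) := by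
  have hf := cont_fT c
  unfold AT
  apply intervalIntegral.continuous_parametric_intervalIntegral_of_continuous'
  unfold Function.uncurry
  fun_prop

lemma h_integrable (c : ℝ) (hc : 0 < c) (n : ℕ) :
    IntegrableOn (fun z => AT c (n * z) / z ^ 2) (Set.Ioi (0:ℝ)) := by
  have hA := (cont_AT c).measurable
  have hd := (dom_integrable (2 * (8 * π * c * n ^ 2 + 4))).integrableOn (s := Set.Ioi (0:ℝ))
  refine Integrable.mono' hd (Measurable.aestronglyMeasurable (by fun_prop)) ?_
  refine (ae_restrict_iff' measurableSet_Ioi).2 (Eventually.of_forall fun z hz => ?_)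
  have hz : 0 < z := hz
  have h0 := AT_nonneg c (n * z)
  rw [Real.norm_of_nonneg (by positivity)]
  have := dom_bound (z := z) (AT_le_four c (n * z)) (L := 8 * π * c * n ^ 2) (by positivity)
    ((AT_le_sq c (n * z) hc (by positivity)).trans (le_of_eq (by ring)))
  refine le_trans ?_ this
  have : 0 ≤ AT c (n * z) / z ^ 2 := by positivity
  have e : AT c (n * z) * (2 / z ^ 2) = 2 * (AT c (n * z) / z ^ 2) := by ring
  rw [e]; linarith

lemma Hz_upper (n : ℕ) (hn : 0 < n) (ε : ℝ) (h0 : 0 < ε) (h1 : ε < 1) :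
    ∫ z in Set.Ioi (0 : ℝ), AT (1 / (2 * π * n * ε)) (n * z) / z ^ 2 ≤
      8 * n * (-Real.log ε) + 4 * n + 4 := by
  set c := 1 / (2 * π * n * ε) with hcdef
  have hn' : (0 : ℝ) < n := by positivity
  have hc : 0 < c := by positivity
  have hI := h_integrable c hc n
  have s1 : IntegrableOn (fun z => AT c (n * z) / z ^ 2) (Set.Ioc 0 ε) :=
    hI.mono_set Set.Ioc_subset_Ioi_self
  have s2 : IntegrableOn (fun z => AT c (n * z) / z ^ 2) (Set.Ioi ε) :=
    hI.mono_set (Set.Ioi_subset_Ioi h0.le)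
  have s3 : IntegrableOn (fun z => AT c (n * z) / z ^ 2) (Set.Ioc ε 1) :=
    s2.mono_set Set.Ioc_subset_Ioi_self
  have s4 : IntegrableOn (fun z => AT c (n * z) / z ^ 2) (Set.Ioi 1) :=
    s2.mono_set (Set.Ioi_subset_Ioi h1.le)
  rw [← Set.Ioc_union_Ioi_eq_Ioi h0.le, setIntegral_union (Set.Ioc_disjoint_Ioi le_rfl) measurableSet_Ioi s1 s2,
    ← Set.Ioc_union_Ioi_eq_Ioi h1.le, setIntegral_union (Set.Ioc_disjoint_Ioi le_rfl) measurableSet_Ioi s3 s4]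
  have b1 : ∫ z in Set.Ioc 0 ε, AT c (n * z) / z ^ 2 ≤ 4 * n := by
    have e : ∫ z in Set.Ioc (0:ℝ) ε, (8 * π * c * (n:ℝ) ^ 2) = 4 * (n:ℝ) := by
      simp [h0.le]; rw [hcdef]; field_simp; norm_num
    rw [← e]
    apply setIntegral_mono_on s1 continuous_const.integrableOn_Ioc measurableSet_Ioc
    intro z hz
    have hz0 : 0 < z := hz.1
    rw [div_le_iff₀ (by positivity)]
    exact (AT_le_sq c (n * z) hc (by positivity)).trans (le_of_eq (by ring))
  have b2 : ∫ z in Set.Ioc ε 1, AT c (n * z) / z ^ 2 ≤ 8 * n * (-Real.log ε) := by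
    have e : ∫ z in Set.Ioc ε 1, (8 * n) * (1 / z) = 8 * n * (-Real.log ε) := by
      rw [← intervalIntegral.integral_of_le h1.le, intervalIntegral.integral_const_mul,
        integral_one_div_of_pos h0 one_pos, one_div, Real.log_inv]
    rw [← e]
    apply setIntegral_mono_on s3 _ measurableSet_Ioc
    · intro z hz
      have hz0 : 0 < z := h0.trans hz.1
      rw [div_le_iff₀ (by positivity)]
      refine (AT_le_lin c (n * z) hc (by positivity)).trans (le_of_eq ?_)
      field_simp
    · rw [← intervalIntegrable_iff_integrableOn_Ioc_of_le h1.le]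
      apply IntervalIntegrable.const_mul
      apply intervalIntegral.intervalIntegrable_one_div _ continuousOn_id
      intro z hz
      rw [Set.uIcc_of_le h1.le] at hz
      exact (h0.trans_le hz.1).ne'
  have b3 : ∫ z in Set.Ioi 1, AT c (n * z) / z ^ 2 ≤ 4 := by
    have i : IntegrableOn (fun z : ℝ => 4 * z ^ (-2 : ℝ)) (Set.Ioi 1) :=
      (integrableOn_Ioi_rpow_of_lt (by norm_num) one_pos).const_mul 4
    have e : ∫ z in Set.Ioi (1:ℝ), 4 * z ^ (-2 : ℝ) = 4 := by
      rw [integral_const_mul, integral_Ioi_rpow_of_lt (by norm_num) one_pos]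
      norm_num
    rw [← e]
    apply setIntegral_mono_on s4 i measurableSet_Ioi
    intro z hz
    have hz0 : (0:ℝ) < z := one_pos.trans hz
    rw [Real.rpow_neg hz0.le, Real.rpow_two, div_eq_mul_inv]
    gcongr
    exact AT_le_four _ _
  linarith

lemma Hz_lower (n : ℕ) (hn : 0 < n) (ε : ℝ) (h0 : 0 < ε) (h1 : 2 * π * n * ε ≤ 1) :
    8 * n * (-Real.log ε - Real.log (2 * n)) - 48 * π * n ≤
    ∫ z in Set.Ioi (0 : ℝ), AT (1 / (2 * π * n * ε)) (n * z) / z ^ 2 := by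
  set c := 1 / (2 * π * n * ε) with hcdef
  have hn' : (0 : ℝ) < n := by positivity
  have hpi := Real.pi_gt_three
  have hc : 0 < c := by positivity
  have hc1 : 1 ≤ c := by rw [hcdef, le_div_iff₀ (by positivity)]; linarith
  have hI := h_integrable c hc n
  set b : ℝ := 1 / (2 * n) with hb
  have hεb : ε ≤ b := by
    rw [hb, le_div_iff₀ (by positivity)]
    have : 0 < n * ε := by positivity
    nlinarith
  have hb0 : 0 < b := by positivity
  have hsub : Set.Ioc ε b ⊆ Set.Ioi 0 := fun z hz => h0.trans hz.1
  have m1 : ∫ z in Set.Ioc ε b, AT c (n * z) / z ^ 2 ≤ ∫ z in Set.Ioi (0 : ℝ), AT c (n * z) / z ^ 2 := by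
    apply setIntegral_mono_set hI
    · exact Eventually.of_forall fun z => div_nonneg (AT_nonneg _ _) (sq_nonneg _)
    · exact hsub.eventuallyLE
  refine le_trans ?_ m1
  have hder : ∀ z ∈ Set.uIcc ε b, HasDerivAt (fun z => 8 * n * Real.log z + (24 / c) * z⁻¹)
      (8 * n * z⁻¹ - (24 / c) / z ^ 2) z := by
    intro z hz
    rw [Set.uIcc_of_le hεb] at hz
    have hz0 : z ≠ 0 := (h0.trans_le hz.1).ne'
    refine (((Real.hasDerivAt_log hz0).const_mul (8 * (n:ℝ))).add
      ((hasDerivAt_inv hz0).const_mul (24 / c))).congr_deriv ?_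
    ring
  have hcont : ContinuousOn (fun z : ℝ => 8 * n * z⁻¹ - (24 / c) / z ^ 2) (Set.uIcc ε b) := by
    have hne : ∀ z ∈ Set.uIcc ε b, z ≠ 0 := fun z hz => by
      rw [Set.uIcc_of_le hεb] at hz
      exact (h0.trans_le hz.1).ne'
    apply ContinuousOn.sub
    · exact continuousOn_const.mul (continuousOn_id.inv₀ hne)
    · exact continuousOn_const.div (continuousOn_id.pow 2) (fun z hz => pow_ne_zero 2 (hne z hz))
  have hii := hcont.intervalIntegrable (μ := volume)
  have e := intervalIntegral.integral_eq_sub_of_hasDerivAt hder hii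
  have m2 : ∫ z in ε..b, (8 * n * z⁻¹ - (24 / c) / z ^ 2) ≤ ∫ z in Set.Ioc ε b, AT c (n * z) / z ^ 2 := by
    rw [intervalIntegral.integral_of_le hεb]
    apply setIntegral_mono_on _ (hI.mono_set hsub) measurableSet_Ioc
    · intro z hz
      have hz0 : 0 < z := h0.trans hz.1
      rw [le_div_iff₀ (by positivity)]
      have hz2 : (n : ℝ) * z ≤ 1 / 2 := by
        have := hz.2
        rw [hb, le_div_iff₀ (by positivity)] at this
        linarith
      refine le_trans (le_of_eq ?_) (AT_lower c (n * z) hc1 (by positivity) hz2)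
      field_simp
    · rwa [← intervalIntegrable_iff_integrableOn_Ioc_of_le hεb]
  refine le_trans ?_ m2
  rw [e]
  have l1 : Real.log b = - Real.log (2 * n) := by rw [hb, one_div, Real.log_inv]
  have l2 : 24 / c * ε⁻¹ = 48 * π * n := by rw [hcdef]; field_simp; norm_num
  have l3 : 0 ≤ 24 / c * b⁻¹ := by positivity
  rw [l1, l2]
  linarith

def mT (c : ℝ) (n : ℕ) (x : R2) : R3 := ![sT c (n * x 0), 0, fT c (n * x 0)]

lemma mT_mag (c : ℝ) (n : ℕ) : Mag (mT c n) := by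
  have hf := contDiff_fT c
  have hs := contDiff_sT c
  refine ⟨?_, ?_, ?_⟩
  · rw [contDiff_pi]
    intro i
    fin_cases i
    · change ContDiff ℝ 1 (fun x : R2 => sT c (n * x 0)); fun_prop
    · change ContDiff ℝ 1 (fun x : R2 => (0:ℝ)); fun_prop
    · change ContDiff ℝ 1 (fun x : R2 => fT c (n * x 0)); fun_prop
  · intro x k
    have e1 : (n : ℝ) * (x 0 + k 0) = n * x 0 + ((n * k 0 : ℤ) : ℝ) := by push_cast; ring
    simp only [mT, Pi.add_apply]
    rw [e1, sT_per, fT_per]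
  · intro x
    have := sT_sq c (n * x 0)
    simp [mT, Fin.sum_univ_three]
    linarith

lemma grad_mT (c : ℝ) (n : ℕ) (x : R2) :
    gradVSq (mT c n) x =
      n ^ 2 * ((2 * π * c * Real.sin (2 * π * (n * x 0))) ^ 2 * sT c (n * x 0) ^ 2) := by
  set G : ℝ → R3 := fun t => ![sT c (n * t), 0, fT c (n * t)] with hG
  set t := (n : ℝ) * x 0 with ht
  set G' : R3 := ![(2 * π * c * Real.sin (2 * π * t)) * (fT c t * sT c t) * n, 0,
    -(2 * π * c * Real.sin (2 * π * t)) * sT c t ^ 2 * n] with hG'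
  have hn : HasDerivAt (fun t : ℝ => n * t) n (x 0) := by
    simpa using (hasDerivAt_id (x 0)).const_mul (n : ℝ)
  have h1 : HasDerivAt G G' (x 0) := by
    rw [hasDerivAt_pi]
    intro i
    fin_cases i
    · exact (hasDeriv_sT c (n * x 0)).comp (x 0) hn
    · exact hasDerivAt_const _ _
    · exact (hasDeriv_fT c (n * x 0)).comp (x 0) hn
  have h2 : HasFDerivAt (fun x : R2 => x 0) (ContinuousLinearMap.proj (R := ℝ) (φ := fun _ : Fin 2 => ℝ) 0) x :=
    (ContinuousLinearMap.proj (R := ℝ) (φ := fun _ : Fin 2 => ℝ) 0).hasFDerivAt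
  have h3 := HasFDerivAt.comp (g := G) (f := fun x : R2 => x 0) x h1.hasFDerivAt h2
  have h4 := h3.fderiv
  have h5 : mT c n = G ∘ (fun x : R2 => x 0) := rfl
  rw [← h5] at h4
  unfold gradVSq
  rw [h4]
  have hs := sT_sq c t
  simp [Fin.sum_univ_three, Fin.sum_univ_two, hG']
  generalize sT c t = s at *
  generalize fT c t = f at *
  linear_combination (n ^ 2 * (2 * π * c * Real.sin (2 * π * t)) ^ 2 * s ^ 2) * hs

lemma local_en (n : ℕ) (hn : 0 < n) (ε : ℝ) (h0 : 0 < ε) :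
    ∫ x in cube, (ε / 2 * gradVSq (mT (1 / (2 * π * n * ε)) n) x +
      (1 - (mT (1 / (2 * π * n * ε)) n x 2) ^ 2) / (2 * ε)) =
    n * (π * (1 / (2 * π * n * ε)) * JT (1 / (2 * π * n * ε))) := by
  set c := 1 / (2 * π * n * ε) with hcdef
  have hn' : (0 : ℝ) < n := by positivity
  have e : ∀ x : R2, (ε / 2 * gradVSq (mT c n) x + (1 - (mT c n x 2) ^ 2) / (2 * ε)) =
      (fun t : ℝ => (1 / (2 * ε)) * (sT c (n * t) ^ 2 * (1 + Real.sin (2 * π * (n * t)) ^ 2))) (x 0) := by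
    intro x
    have : mT c n x 2 = fT c (n * x 0) := rfl
    rw [grad_mT, this, ← sT_sq]
    have : (n:ℝ) ^ 2 * (2 * π * c * Real.sin (2 * π * (n * x 0))) ^ 2 =
      Real.sin (2 * π * (n * x 0)) ^ 2 / ε ^ 2 := by
      rw [hcdef]; field_simp
    rw [← mul_assoc (n ^ 2 : ℝ), this]
    field_simp; ring
  simp only [e]
  rw [cube_int (fun t : ℝ => (1 / (2 * ε)) * (sT c (n * t) ^ 2 * (1 + Real.sin (2 * π * (n * t)) ^ 2))),
    intervalIntegral.integral_const_mul,
    per_int_scale (g := fun t => sT c t ^ 2 * (1 + Real.sin (2 * π * t) ^ 2)) _ (cont_J c) hn]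
  · rw [← JT, hcdef]; field_simp
  · intro t
    simp only
    rw [sT_per1 c t, show 2 * π * (t + 1) = 2 * π * t + 2 * π by ring, Real.sin_add_two_pi]

lemma F_bound (n : ℕ) (hn : 0 < n) (ε : ℝ) (h0 : 0 < ε) (h1 : 2 * π * n * ε ≤ 1) :
    |Fen ε (π / 2) (mT (1 / (2 * π * n * ε)) n)| ≤
      (2 * π ^ 2 * n ^ 2 + 8 * π * n ^ 2) * ε +
      (4 * n * Real.log (2 * n) + 24 * π * n + 2 * n + 2) * (1 / |Real.log ε|) := by
  have hn' : (1 : ℝ) ≤ n := by exact_mod_cast hn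
  have hpi := Real.pi_gt_three
  have hε1 : ε < 1 := by nlinarith [mul_pos (show (0:ℝ) < n by linarith) h0]
  have hlog : Real.log ε < 0 := Real.log_neg h0 hε1
  have hu := Hz_upper n hn ε h0 hε1
  have hl := Hz_lower n hn ε h0 h1
  unfold Fen
  rw [local_en n hn ε h0]
  have hc : 0 < 1 / (2 * π * n * ε) := by positivity
  have e : H12 (fun x => mT (1 / (2 * π * n * ε)) n x 2) = _ := H12_red (1 / (2 * π * n * ε)) hc n hn
  rw [e, abs_of_neg hlog]
  have j1 := J_lower hc
  have j2 := J_upper hc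
  have t1 := tc_le_one (1 / (2 * π * n * ε))
  have t2 := tc_lower hc
  have c1 : 1 / (1 / (2 * π * n * ε)) = 2 * π * n * ε := by simp
  have c2 : π / (1 / (2 * π * n * ε)) = 2 * π ^ 2 * n * ε := by field_simp
  rw [c1] at t2
  rw [c2] at j2
  set c := 1 / (2 * π * n * ε)
  set H := ∫ z in Set.Ioi (0 : ℝ), AT c (n * z) / z ^ 2
  set L := -Real.log ε with hL
  have hL0 : 0 < L := by linarith
  set Q := π * c * JT c
  have hlog2 : 0 ≤ Real.log (2 * n) := Real.log_nonneg (by linarith)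
  have e2 : π / 2 / L * (1 / π * H) = H * (1 / L) / 2 := by field_simp
  rw [e2]
  set r := 1 / L with hr
  have hr0 : 0 < r := by positivity
  have hLr : L * r = 1 := by rw [hr]; field_simp
  have u2 : H * r ≤ (8 * n * L + 4 * n + 4) * r := by gcongr
  have l2 : (8 * n * (L - Real.log (2 * n)) - 48 * π * n) * r ≤ H * r := by gcongr
  have u3 : (8 * n * L + 4 * n + 4) * r = 8 * n + (4 * n + 4) * r := by
    linear_combination 8 * n * hLr
  have l3 : (8 * n * (L - Real.log (2 * n)) - 48 * π * n) * r = 8 * n - (8 * n * Real.log (2 * n) + 48 * π * n) * r := by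
    linear_combination 8 * n * hLr
  have Q1 : n * Q ≤ n * (4 + 2 * π ^ 2 * n * ε) := by gcongr; linarith
  have Q2 : n * (4 * (1 - 2 * π * n * ε)) ≤ n * Q := by gcongr; linarith
  have p1 : 0 ≤ n * Real.log (2 * n) * r := by positivity
  have p2 : 0 ≤ π * n * r := by positivity
  have p3 : 0 ≤ n * r := by positivity
  have p4 : 0 ≤ π ^ 2 * n ^ 2 * ε := by positivity
  have p5 : 0 ≤ π * n ^ 2 * ε := by positivity
  rw [abs_le]
  constructor <;> nlinarith

lemma orth (c d : ℝ) (a b : ℕ) (hab : a < b) :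
    ∫ x in (0:ℝ)..1, fT c ((2 ^ a : ℕ) * x) * fT d ((2 ^ b : ℕ) * x) = 0 := by
  set g : ℝ → ℝ := fun x => fT c ((2 ^ a : ℕ) * x) * fT d ((2 ^ b : ℕ) * x) with hg
  have hper : Function.Periodic g 1 := fun x => by
    simp only [hg]
    have e1 := fT_per c ((2 ^ a : ℕ) * x) ((2 ^ a : ℕ) : ℤ)
    have e2 := fT_per d ((2 ^ b : ℕ) * x) ((2 ^ b : ℕ) : ℤ)
    simp only [Int.cast_natCast] at e1 e2
    rw [mul_add, mul_add, mul_one, mul_one, e1, e2]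
  have hsh : ∀ x, g (x + 1 / (2 * 2 ^ a)) = - g x := fun x => by
    obtain ⟨k, rfl⟩ : ∃ k, b = a + 1 + k := ⟨b - (a + 1), by omega⟩
    simp only [hg]
    have e2 := fT_per d ((2 ^ (a + 1 + k) : ℕ) * x) ((2 ^ k : ℕ) : ℤ)
    have h1 : ((2 ^ a : ℕ) : ℝ) * (x + 1 / (2 * 2 ^ a)) = (2 ^ a : ℕ) * x + 1 / 2 := by
      push_cast; field_simp
    have h2 : ((2 ^ (a + 1 + k) : ℕ) : ℝ) * (x + 1 / (2 * 2 ^ a)) =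
        (2 ^ (a + 1 + k) : ℕ) * x + (((2 ^ k : ℕ) : ℤ) : ℝ) := by
      push_cast; field_simp; ring
    rw [h1, h2, e2, fT_half]; ring
  have h := per_int_shift hper (1 / (2 * 2 ^ a))
  simp only [hsh] at h
  rw [intervalIntegral.integral_neg] at h
  linarith

lemma norm_lower (c : ℝ) (hc : 6 ≤ c) (n : ℕ) (hn : 0 < n) :
    1 / 2 ≤ ∫ x in (0:ℝ)..1, fT c (n * x) ^ 2 := by
  have hf := cont_fT c
  have hs := cont_sT c
  rw [per_int_scale (g := fun x => fT c x ^ 2) (fun x => by simp only [fT_per1 c x]) (by fun_prop) hn]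
  have h := int_s_le (c := c) (by linarith)
  have e : ∫ x in (0:ℝ)..1, fT c x ^ 2 = 1 - ∫ x in (0:ℝ)..1, sT c x ^ 2 := by
    have : ∫ x in (0:ℝ)..1, (1 - sT c x ^ 2) = 1 - ∫ x in (0:ℝ)..1, sT c x ^ 2 := by
      rw [intervalIntegral.integral_sub (by simp) (Continuous.intervalIntegrable (by fun_prop) _ _)]
      simp
    rw [← this]
    congr 1; ext x; rw [sT_sq]; ring
  have : 3 / c ≤ 1 / 2 := by rw [div_le_iff₀ (by linarith)]; linarith
  linarith

lemma sep (c d : ℝ) (hc : 6 ≤ c) (hd : 6 ≤ d) (a b : ℕ) (hab : a < b) :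
    1 / 2 ≤ ∫ x in (0:ℝ)..1, |fT c ((2 ^ a : ℕ) * x) - fT d ((2 ^ b : ℕ) * x)| := by
  have hf := cont_fT c
  have hf2 := cont_fT d
  have h1 := norm_lower c hc (2 ^ a) (by positivity)
  have h2 := norm_lower d hd (2 ^ b) (by positivity)
  have h3 := orth c d a b hab
  have e : ∫ x in (0:ℝ)..1, (fT c ((2 ^ a : ℕ) * x) - fT d ((2 ^ b : ℕ) * x)) ^ 2 =
      (∫ x in (0:ℝ)..1, fT c ((2 ^ a : ℕ) * x) ^ 2) + (∫ x in (0:ℝ)..1, fT d ((2 ^ b : ℕ) * x) ^ 2)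
      - 2 * ∫ x in (0:ℝ)..1, fT c ((2 ^ a : ℕ) * x) * fT d ((2 ^ b : ℕ) * x) := by
    rw [← intervalIntegral.integral_const_mul, ← intervalIntegral.integral_add,
      ← intervalIntegral.integral_sub]
    · congr 1; ext x; ring
    all_goals exact Continuous.intervalIntegrable (by fun_prop) _ _
  have m : ∫ x in (0:ℝ)..1, (fT c ((2 ^ a : ℕ) * x) - fT d ((2 ^ b : ℕ) * x)) ^ 2 ≤
      ∫ x in (0:ℝ)..1, 2 * |fT c ((2 ^ a : ℕ) * x) - fT d ((2 ^ b : ℕ) * x)| := by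
    apply intervalIntegral.integral_mono_on (by norm_num)
      (Continuous.intervalIntegrable (by fun_prop) _ _)
      (Continuous.intervalIntegrable (by fun_prop) _ _)
    intro x _
    have q1 := abs_le.1 (abs_fT_le c ((2 ^ a : ℕ) * x))
    have q2 := abs_le.1 (abs_fT_le d ((2 ^ b : ℕ) * x))
    have q3 : |fT c ((2 ^ a : ℕ) * x) - fT d ((2 ^ b : ℕ) * x)| ≤ 2 := by
      rw [abs_le]; constructor <;> linarith
    rw [← sq_abs]
    nlinarith [abs_nonneg (fT c ((2 ^ a : ℕ) * x) - fT d ((2 ^ b : ℕ) * x))]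
  rw [intervalIntegral.integral_const_mul] at m
  linarith

lemma choose_eps (k : ℕ) : ∃ ε : ℝ, 0 < ε ∧ ε < 1 ∧ ε ≤ 1 / ((k : ℝ) + 1) ∧
    6 ≤ 1 / (2 * π * (2 ^ k : ℕ) * ε) ∧
    |Fen ε (π / 2) (mT (1 / (2 * π * (2 ^ k : ℕ) * ε)) (2 ^ k))| ≤ 1 / ((k : ℝ) + 1) := by
  set n : ℕ := 2 ^ k with hn
  have hn0 : 0 < n := by positivity
  have hn' : (0:ℝ) < n := by positivity
  have hpi := Real.pi_pos
  set A : ℝ := 2 * π ^ 2 * n ^ 2 + 8 * π * n ^ 2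
  set B : ℝ := 4 * n * Real.log (2 * n) + 24 * π * n + 2 * n + 2
  have t0 : Tendsto (fun ε : ℝ => ε) (nhdsWithin 0 (Set.Ioi 0)) (nhds 0) :=
    tendsto_id.mono_left nhdsWithin_le_nhds
  have t1 : Tendsto (fun ε : ℝ => A * ε + B * (1 / |Real.log ε|)) (nhdsWithin 0 (Set.Ioi 0)) (nhds 0) := by
    have l := (tendsto_abs_atBot_atTop.comp Real.tendsto_log_nhdsGT_zero).inv_tendsto_atTop
    have := (t0.const_mul A).add (l.const_mul B)
    simpa using this
  have hk : (0:ℝ) < 1 / ((k : ℝ) + 1) := by positivity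
  have ev : ∀ᶠ ε in nhdsWithin (0:ℝ) (Set.Ioi 0), 0 < ε ∧ ε < 1 ∧ ε ≤ 1 / ((k : ℝ) + 1) ∧
      ε < 1 / (12 * π * n) ∧ A * ε + B * (1 / |Real.log ε|) < 1 / ((k : ℝ) + 1) := by
    filter_upwards [self_mem_nhdsWithin, t0.eventually_lt_const one_pos, t0.eventually_lt_const hk,
      t0.eventually_lt_const (show (0:ℝ) < 1 / (12 * π * n) by positivity),
      t1.eventually_lt_const hk] with ε a b c d e
    exact ⟨a, b, c.le, d, e⟩
  obtain ⟨ε, h0, h1, h2, h3, h4⟩ := ev.exists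
  rw [lt_div_iff₀ (by positivity)] at h3
  refine ⟨ε, h0, h1, h2, ?_, ?_⟩
  · rw [le_div_iff₀ (by positivity)]; linarith
  · have : 0 < π * n * ε := by positivity
    exact (F_bound n hn0 ε h0 (by linarith)).trans h4.le

lemma abs_le_en3 (v : R3) (i : Fin 3) : |v i| ≤ en3 v := by
  rw [en3, ← Real.sqrt_sq_eq_abs]
  apply Real.sqrt_le_sqrt
  exact Finset.single_le_sum (f := fun i => v i ^ 2) (fun i _ => sq_nonneg _) (Finset.mem_univ i)

lemma en3_le (v : R3) : en3 v ≤ 3 * ‖v‖ := by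
  rw [en3]
  apply Real.sqrt_le_iff.2
  refine ⟨by positivity, ?_⟩
  have h : ∀ i, v i ^ 2 ≤ ‖v‖ ^ 2 := fun i => by
    rw [← sq_abs]
    have := norm_le_pi_norm v i
    rw [Real.norm_eq_abs] at this
    gcongr
  rw [Fin.sum_univ_three]
  nlinarith [h 0, h 1, h 2, sq_nonneg ‖v‖]

lemma cont_en3 : Continuous en3 := by unfold en3; fun_prop

lemma cube_sub : cube ⊆ Set.Icc (0 : R2) 1 := by
  intro x hx
  exact ⟨fun i => (hx i trivial).1, fun i => (hx i trivial).2.le⟩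

lemma int_en3 (m g : R2 → R3) (hm : Continuous m) (hg : IntegrableOn g cube) :
    IntegrableOn (fun x => en3 (m x - g x)) cube := by
  have hm1 : IntegrableOn m cube :=
    (hm.continuousOn.integrableOn_compact isCompact_Icc).mono_set cube_sub
  have h := Integrable.sub hm1 hg
  refine Integrable.mono' (h.norm.const_mul 3) (cont_en3.comp_aestronglyMeasurable h.1) ?_
  refine Eventually.of_forall fun x => ?_
  rw [Real.norm_of_nonneg (show 0 ≤ en3 (m x - g x) from Real.sqrt_nonneg _)]
  exact en3_le _

/-- Theorem `th:crit-F`, item (iii), lack of compactness at the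
critical parameter `λ_c = π/2`: there is a sequence with vanishing energy that has no
`L¹`-convergent subsequence. -/
theorem stmt_17 :
    ∃ (ε : ℕ → ℝ) (m : ℕ → R2 → R3),
      (∀ k, 0 < ε k ∧ ε k < 1) ∧ Tendsto ε atTop (nhds 0) ∧
      (∀ k, Mag (m k)) ∧
      Tendsto (fun k => Fen (ε k) (π / 2) (m k)) atTop (nhds 0) ∧
      ∀ φ : ℕ → ℕ, StrictMono φ → ∀ g : R2 → R3, IntegrableOn g cube →
        ¬ Tendsto (fun k => ∫ x in cube, en3 (m (φ k) x - g x)) atTop (nhds 0) := by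
  choose ε h0 h1 h2 h3 h4 using choose_eps
  refine ⟨ε, fun k => mT (1 / (2 * π * (2 ^ k : ℕ) * ε k)) (2 ^ k), fun k => ⟨h0 k, h1 k⟩, ?_,
    fun k => mT_mag _ _, ?_, ?_⟩
  · exact squeeze_zero (fun k => (h0 k).le) h2 tendsto_one_div_add_atTop_nhds_zero_nat
  · exact squeeze_zero_norm h4 tendsto_one_div_add_atTop_nhds_zero_nat
  · intro φ hφ g hg ht
    set m : ℕ → R2 → R3 := fun k => mT (1 / (2 * π * (2 ^ k : ℕ) * ε k)) (2 ^ k) with hm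
    have ht2 := ht.comp (tendsto_add_atTop_nat 1)
    have ht3 := ht.add ht2
    rw [add_zero] at ht3
    have hcm : ∀ k, Continuous (m k) := fun k => (mT_mag _ _).1.continuous
    have key : ∀ k, (1 / 2 : ℝ) ≤ (∫ x in cube, en3 (m (φ k) x - g x)) +
        ∫ x in cube, en3 (m (φ (k + 1)) x - g x) := by
      intro k
      have s := sep _ _ (h3 (φ k)) (h3 (φ (k + 1))) _ _ (hφ (Nat.lt_succ_self k))
      rw [← cube_int (fun t => |fT (1 / (2 * π * (2 ^ φ k : ℕ) * ε (φ k))) ((2 ^ φ k : ℕ) * t)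
        - fT (1 / (2 * π * (2 ^ φ (k + 1) : ℕ) * ε (φ (k + 1)))) ((2 ^ φ (k + 1) : ℕ) * t)|)] at s
      refine s.trans ?_
      rw [← integral_add (int_en3 _ _ (hcm _) hg) (int_en3 _ _ (hcm _) hg)]
      apply integral_mono_of_nonneg
      · exact Eventually.of_forall fun x => abs_nonneg _
      · exact Integrable.add (int_en3 _ _ (hcm _) hg) (int_en3 _ _ (hcm _) hg)
      · refine Eventually.of_forall fun x => ?_
        have a1 := abs_le_en3 (m (φ k) x - g x) 2
        have a2 := abs_le_en3 (m (φ (k + 1)) x - g x) 2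
        refine le_trans ?_ (add_le_add a1 a2)
        simp only [Pi.sub_apply]
        rw [abs_sub_comm (m (φ (k + 1)) x 2)]
        exact abs_sub_le (m (φ k) x 2) (g x 2) (m (φ (k + 1)) x 2)
    have := ge_of_tendsto' ht3 key
    norm_num at this
end
end

section
/- Compactness upon rescaling at the critical parameter: for every C > 0, every sequence ε_k → 0 and every sequence m_k ∈ H¹(𝕋²; S²) satisfying F_{ε_k,λ_c}[m_k] ≤ C / |log ε_k| for all k, there is a subsequence of (m_k) converging in L¹(𝕋²; ℝ³) to a limit m ∈ BV(𝕋²; {±e₃}). -/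
open MeasureTheory Real Filter

noncomputable section

/-- Admissible test vector fields for the dual definition of the total variation:
smooth `ℤ²`-periodic fields with Euclidean norm at most `1`. -/
def IsAdmField (φ : R2 → R2) : Prop :=
  ContDiff ℝ (⊤ : ℕ∞) φ ∧
    (∀ (x : R2) (n : Fin 2 → ℤ), φ (x + fun i => (n i : ℝ)) = φ x) ∧
    ∀ x, en2 (φ x) ≤ 1

/-- The set of dual pairings `∫_{𝕋²} u ∇·φ dx` over admissible fields `φ`. -/
def TVset (u : R2 → ℝ) : Set ℝ :=
  {t | ∃ φ : R2 → R2, IsAdmField φ ∧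
    t = ∫ x in cube, u x * ∑ i, fderiv ℝ φ x (Pi.single i 1) i}

/-- The total variation `∫_{𝕋²} |∇u|` of a function on the torus. -/
def TV (u : R2 → ℝ) : ℝ := sSup (TVset u)

/-- Membership in `BV(𝕋²; {±e₃})`: `m` takes a.e. only the values `±e₃` and its third
component has finite total variation. -/
def IsBVpm (m : R2 → R3) : Prop :=
  (∀ᵐ x ∂(volume.restrict cube), m x = e3 ∨ m x = -e3) ∧
    BddAbove (TVset fun x => m x 2)


/-- `ℤ²`-periodicity of a map on the plane. -/
def PerZ {α : Type*} (g : R2 → α) : Prop :=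
  ∀ (x : R2) (n : Fin 2 → ℤ), g (x + fun i => (n i : ℝ)) = g x

lemma cube_eq_fd : cube = ZSpan.fundamentalDomain (Pi.basisFun ℝ (Fin 2)) := by
  ext x
  simp [cube, ZSpan.mem_fundamentalDomain, Set.mem_pi]

lemma meas_cube : MeasurableSet cube :=
  MeasurableSet.univ_pi fun _ => measurableSet_Ico

lemma vol_cube : volume cube = 1 := by
  simp [cube, volume_pi_pi]

instance : IsProbabilityMeasure (volume.restrict cube) :=
  ⟨by simp [vol_cube]⟩

lemma cont_int {E : Type*} [NormedAddCommGroup E] {g : R2 → E} (hg : Continuous g) :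
    IntegrableOn g cube :=
  (hg.continuousOn.integrableOn_compact isCompact_Icc).mono_set cube_sub

lemma fd_cube : IsAddFundamentalDomain
    (Submodule.span ℤ (Set.range (Pi.basisFun ℝ (Fin 2)))).toAddSubgroup cube volume := by
  rw [cube_eq_fd]
  exact ZSpan.isAddFundamentalDomain' _ _

instance : Countable
    (Submodule.span ℤ (Set.range (Pi.basisFun ℝ (Fin 2)))).toAddSubgroup :=
  inferInstanceAs (Countable (Submodule.span ℤ (Set.range (Pi.basisFun ℝ (Fin 2)))))

lemma per_span {α : Type*} {g : R2 → α} (hg : PerZ g)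
    (l : (Submodule.span ℤ (Set.range (Pi.basisFun ℝ (Fin 2)))).toAddSubgroup) (x : R2) :
    g (l +ᵥ x) = g x := by
  obtain ⟨l, hl⟩ := l
  have hl' : l ∈ Submodule.span ℤ (Set.range (Pi.basisFun ℝ (Fin 2))) := hl
  rw [Submodule.mem_span_range_iff_exists_fun] at hl'
  obtain ⟨c, rfl⟩ := hl'
  rw [← hg x c]
  congr 1
  change (∑ i, c i • (Pi.basisFun ℝ (Fin 2)) i) + x = _
  ext j
  fin_cases j <;> simp [Fin.sum_univ_two] <;> ring

lemma shift_lint {g : R2 → ENNReal} (hg : PerZ g) (z : R2) :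
    ∫⁻ x in cube, g (x + z) = ∫⁻ x in cube, g x := by
  have h1 := fd_cube.vadd_of_comm z
  rw [fd_cube.setLIntegral_eq h1 g (fun l x => per_span hg l x)]
  have := (measurePreserving_add_left (volume : Measure R2) z).setLIntegral_comp_emb
    (measurableEmbedding_addLeft z) g cube
  change _ = ∫⁻ x in (fun y => z + y) '' cube, g x
  rw [← this]
  simp [add_comm]

lemma shift_int {g : R2 → ℝ} (hg : PerZ g) (z : R2) :
    ∫ x in cube, g (x + z) = ∫ x in cube, g x := by
  have h1 := fd_cube.vadd_of_comm z
  rw [fd_cube.setIntegral_eq h1 (f := g) (fun l x => per_span hg l x)]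
  have := (measurePreserving_add_left (volume : Measure R2) z).setIntegral_image_emb
    (measurableEmbedding_addLeft z) g cube
  change _ = ∫ x in (fun y => z + y) '' cube, g x
  rw [this]
  simp [add_comm]

lemma per_fderiv {f : R2 → ℝ} (hf : PerZ f) : PerZ (fderiv ℝ f) := by
  intro x n
  have : (fun y => f (y + fun i => (n i : ℝ))) = f := by
    funext y; exact hf y n
  rw [← fderiv_comp_add_right, this]

lemma ftc {f : R2 → ℝ} (hf : ContDiff ℝ 1 f) (x z : R2) :
    f (x + z) - f x = ∫ t in Set.Ioc (0 : ℝ) 1, fderiv ℝ f (x + t • z) z := by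
  rw [← intervalIntegral.integral_of_le zero_le_one]
  have hd : ∀ t : ℝ, HasDerivAt (fun t : ℝ => f (x + t • z)) (fderiv ℝ f (x + t • z) z) t := by
    intro t
    have h1 : HasDerivAt (fun t : ℝ => x + t • z) z t := by
      simpa using ((hasDerivAt_id t).smul_const z).const_add x
    exact ((hf.differentiable one_ne_zero _).hasFDerivAt).comp_hasDerivAt t h1
  have hc : Continuous (fun t : ℝ => fderiv ℝ f (x + t • z) z) := by
    have := hf.continuous_fderiv one_ne_zero
    fun_prop
  rw [intervalIntegral.integral_eq_sub_of_hasDerivAt (fun t _ => hd t)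
    (hc.intervalIntegrable _ _)]
  simp

instance : IsProbabilityMeasure (volume.restrict (Set.Ioc (0 : ℝ) 1)) :=
  ⟨by simp⟩

/-- Convex functions of finite differences are controlled by those of the derivative. -/
lemma diff_convex {f : R2 → ℝ} (hf : ContDiff ℝ 1 f) (hp : PerZ f) {Φ : ℝ → ℝ}
    (hΦ : ConvexOn ℝ Set.univ Φ) (hc : Continuous Φ) (h0 : ∀ t, 0 ≤ Φ t) (z : R2) :
    ∫⁻ x in cube, ENNReal.ofReal (Φ (f (x + z) - f x)) ≤
      ∫⁻ x in cube, ENNReal.ofReal (Φ (fderiv ℝ f x z)) := by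
  have hcf := hf.continuous_fderiv one_ne_zero
  have hcI : ∀ x, Continuous (fun t : ℝ => fderiv ℝ f (x + t • z) z) := by
    intro x; fun_prop
  have key : ∀ x, ENNReal.ofReal (Φ (f (x + z) - f x)) ≤
      ∫⁻ t in Set.Ioc (0 : ℝ) 1, ENNReal.ofReal (Φ (fderiv ℝ f (x + t • z) z)) := by
    intro x
    have hi : ∀ {h : ℝ → ℝ}, Continuous h → IntegrableOn h (Set.Ioc (0 : ℝ) 1) := fun hh =>
      (hh.continuousOn.integrableOn_compact isCompact_Icc).mono_set Set.Ioc_subset_Icc_self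
    rw [ftc hf, ← ofReal_integral_eq_lintegral_ofReal
      (f := fun t => Φ (fderiv ℝ f (x + t • z) z)) (hi (hc.comp (hcI x)))
      (Eventually.of_forall fun t => h0 _)]
    apply ENNReal.ofReal_le_ofReal
    exact hΦ.map_integral_le hc.continuousOn isClosed_univ (by simp) (hi (hcI x))
      (hi (hc.comp (hcI x)))
  calc _ ≤ ∫⁻ x in cube, ∫⁻ t in Set.Ioc (0 : ℝ) 1,
          ENNReal.ofReal (Φ (fderiv ℝ f (x + t • z) z)) := lintegral_mono key
    _ = ∫⁻ t in Set.Ioc (0 : ℝ) 1, ∫⁻ x in cube,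
          ENNReal.ofReal (Φ (fderiv ℝ f (x + t • z) z)) := by
        apply lintegral_lintegral_swap
        have : Continuous (Function.uncurry fun (x : R2) (t : ℝ) =>
            ENNReal.ofReal (Φ (fderiv ℝ f (x + t • z) z))) := by
          apply ENNReal.continuous_ofReal.comp
          apply hc.comp
          have h2 : Continuous fun p : R2 × ℝ => fderiv ℝ f (p.1 + p.2 • z) := by fun_prop
          exact h2.clm_apply continuous_const
        exact this.measurable.aemeasurable
    _ = ∫⁻ t in Set.Ioc (0 : ℝ) 1, ∫⁻ x in cube, ENNReal.ofReal (Φ (fderiv ℝ f x z)) := by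
        congr 1; funext t
        apply shift_lint (g := fun x => ENNReal.ofReal (Φ (fderiv ℝ f x z)))
        intro x n
        simp only [per_fderiv hp x n]
    _ = _ := by simp

lemma int_partial_zero {ψ : R2 → ℝ} (hf : ContDiff ℝ 1 ψ) (hp : PerZ ψ) (n : Fin 2 → ℤ) :
    ∫ x in cube, fderiv ℝ ψ x (fun i => (n i : ℝ)) = 0 := by
  set e : R2 := fun i => (n i : ℝ)
  have hcf := hf.continuous_fderiv one_ne_zero
  have h1 : ∀ x, ∫ t in Set.Ioc (0 : ℝ) 1, fderiv ℝ ψ (x + t • e) e = 0 := by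
    intro x; rw [← ftc hf, hp x n, sub_self]
  have h2 : ∫ x in cube, ∫ t in Set.Ioc (0 : ℝ) 1, fderiv ℝ ψ (x + t • e) e = 0 := by
    simp [h1]
  rw [integral_integral_swap] at h2
  · have h3 : ∀ t : ℝ, ∫ x in cube, fderiv ℝ ψ (x + t • e) e = ∫ x in cube, fderiv ℝ ψ x e := by
      intro t
      apply shift_int (g := fun x => fderiv ℝ ψ x e)
      intro x n
      simp only [per_fderiv hp x n]
    simpa [h3] using h2
  · rw [Measure.prod_restrict]
    have h2 : Continuous (Function.uncurry fun (x : R2) (t : ℝ) => fderiv ℝ ψ (x + t • e) e) := by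
      have h2 : Continuous fun p : R2 × ℝ => fderiv ℝ ψ (p.1 + p.2 • e) := by fun_prop
      exact h2.clm_apply continuous_const
    exact (h2.continuousOn.integrableOn_compact (isCompact_Icc.prod isCompact_Icc)).mono_set
      (Set.prod_mono cube_sub Set.Ioc_subset_Icc_self)

lemma polar_lint {G : R2 → ENNReal} (hG : Measurable G) :
    ∫⁻ z, G z = ∫⁻ r in Set.Ioi (0 : ℝ), ∫⁻ θ in Set.Ioo (-π) π,
      ENNReal.ofReal r * G ![r * cos θ, r * sin θ] := by
  have h1 := (volume_preserving_finTwoArrow ℝ).symm.lintegral_comp_emb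
    (MeasurableEquiv.finTwoArrow.symm.measurableEmbedding) G
  rw [← h1, ← lintegral_comp_polarCoord_symm, polarCoord_target, Measure.volume_eq_prod,
    ← Measure.prod_restrict, lintegral_prod]
  · simp only [polarCoord_symm_apply, smul_eq_mul]
    rfl
  · apply Measurable.aemeasurable
    apply Measurable.mul
    · exact ENNReal.measurable_ofReal.comp measurable_fst
    · apply hG.comp
      apply MeasurableEquiv.finTwoArrow.symm.measurable.comp
      have : (fun p : ℝ × ℝ => polarCoord.symm p) = fun p => (p.1 * cos p.2, p.1 * sin p.2) := by
        funext p; exact polarCoord_symm_apply p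
      change Measurable fun p : ℝ × ℝ => polarCoord.symm p
      rw [this]
      fun_prop

lemma int_abs_cos : ∫ θ in (-π)..π, |cos θ| = 4 := by
  have hper : Function.Periodic (fun θ => |cos θ|) π := by
    intro θ; simp [cos_add_pi]
  have hi : ∀ a b, IntervalIntegrable (fun θ => |cos θ|) volume a b := fun a b =>
    (continuous_cos.abs).intervalIntegrable _ _
  have h0 : ∫ θ in (-(π/2))..(-(π/2) + π), |cos θ| = 2 := by
    have : ∫ θ in (-(π/2))..(-(π/2) + π), |cos θ| = ∫ θ in (-(π/2))..(-(π/2) + π), cos θ := by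
      apply intervalIntegral.integral_congr
      intro θ hθ
      rw [Set.uIcc_of_le (by linarith [pi_pos])] at hθ
      exact abs_of_nonneg (cos_nonneg_of_mem_Icc ⟨hθ.1, by linarith [hθ.2]⟩)
    rw [this, integral_cos]
    have : -(π/2) + π = π/2 := by ring
    rw [this, sin_neg, sin_pi_div_two]; norm_num
  have h1 : ∫ θ in (-π)..(-π + π), |cos θ| = 2 := by
    rw [hper.intervalIntegral_add_eq (-π) (-(π/2)), h0]
  have h2 : ∫ θ in (0:ℝ)..(0 + π), |cos θ| = 2 := by
    rw [hper.intervalIntegral_add_eq 0 (-(π/2)), h0]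
  rw [← intervalIntegral.integral_add_adjacent_intervals (hi (-π) 0) (hi 0 π)]
  simp only [neg_add_cancel, zero_add] at h1 h2
  rw [h1, h2]; norm_num

lemma int_abs_trig (a b : ℝ) :
    ∫ θ in (-π)..π, |a * cos θ + b * sin θ| = 4 * sqrt (a ^ 2 + b ^ 2) := by
  set w : ℂ := ⟨a, b⟩
  have hn : ‖w‖ = sqrt (a ^ 2 + b ^ 2) := by
    rw [Complex.norm_def, Complex.normSq_apply]; simp [w, sq]
  have ha : a = ‖w‖ * cos w.arg := by rw [Complex.norm_mul_cos_arg]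
  have hb : b = ‖w‖ * sin w.arg := by rw [Complex.norm_mul_sin_arg]
  have h : ∀ θ, |a * cos θ + b * sin θ| = ‖w‖ * |cos (θ - w.arg)| := by
    intro θ
    rw [cos_sub, ← abs_of_nonneg (norm_nonneg w), ← abs_mul]
    congr 1
    conv_lhs => rw [ha, hb]
    ring
  simp_rw [h]
  rw [intervalIntegral.integral_const_mul, intervalIntegral.integral_comp_sub_right
    (fun θ => |cos θ|)]
  have hper : Function.Periodic (fun θ => |cos θ|) (2 * π) := by
    intro θ; simp
  have := hper.intervalIntegral_add_eq (-π - w.arg) (-π)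
  have e1 : -π - w.arg + 2 * π = π - w.arg := by ring
  have e2 : -π + 2 * π = π := by ring
  rw [e1, e2] at this
  rw [this, int_abs_cos, hn]; ring

lemma lint_abs_trig (a b : ℝ) :
    ∫⁻ θ in Set.Ioo (-π) π, ENNReal.ofReal |a * cos θ + b * sin θ| =
      ENNReal.ofReal (4 * sqrt (a ^ 2 + b ^ 2)) := by
  rw [← int_abs_trig, intervalIntegral.integral_of_le (by linarith [pi_pos]),
    ofReal_integral_eq_lintegral_ofReal, restrict_Ioo_eq_restrict_Ioc]
  · have : Continuous fun θ => |a * cos θ + b * sin θ| := by fun_prop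
    exact (this.continuousOn.integrableOn_compact isCompact_Icc).mono_set Set.Ioc_subset_Icc_self
  · exact Eventually.of_forall fun _ => abs_nonneg _

lemma fderiv_pv (f : R2 → ℝ) (x : R2) (a b : ℝ) :
    fderiv ℝ f x ![a, b] = fderiv ℝ f x (Pi.single 0 1) * a + fderiv ℝ f x (Pi.single 1 1) * b := by
  have : (![a, b] : R2) = a • (Pi.single 0 1 : R2) + b • (Pi.single 1 1 : R2) := by
    ext i; fin_cases i <;> simp
  rw [this, map_add, map_smul, map_smul, smul_eq_mul, smul_eq_mul]; ring

lemma gradNormSq_eq (f : R2 → ℝ) (x : R2) : gradNormSq f x =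
    fderiv ℝ f x (Pi.single 0 1) ^ 2 + fderiv ℝ f x (Pi.single 1 1) ^ 2 := by
  simp [gradNormSq, Fin.sum_univ_two]

lemma gradNormSq_nonneg (f : R2 → ℝ) (x : R2) : 0 ≤ gradNormSq f x := by
  rw [gradNormSq_eq]; positivity

lemma cont_gradNormSq {f : R2 → ℝ} (hf : ContDiff ℝ 1 f) : Continuous (gradNormSq f) := by
  have hcf := hf.continuous_fderiv one_ne_zero
  unfold gradNormSq
  fun_prop

lemma cont_gradNorm {f : R2 → ℝ} (hf : ContDiff ℝ 1 f) : Continuous (gradNorm f) :=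
  continuous_sqrt.comp (cont_gradNormSq hf)

/-- Squared difference integrated over the torus. -/
def Gd (f : R2 → ℝ) (z : R2) : ENNReal :=
  ∫⁻ x in cube, ENNReal.ofReal ((f (x + z) - f x) ^ 2)

lemma meas_fderiv_pv {f : R2 → ℝ} (hf : ContDiff ℝ 1 f) {Φ : ℝ → ℝ} (hc : Continuous Φ) (r : ℝ) :
    Measurable (Function.uncurry fun (θ : ℝ) (x : R2) =>
      ENNReal.ofReal (Φ (fderiv ℝ f x ![r * cos θ, r * sin θ]))) := by
  have hcf := hf.continuous_fderiv one_ne_zero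
  simp_rw [fderiv_pv]
  apply Continuous.measurable
  apply ENNReal.continuous_ofReal.comp
  apply hc.comp
  fun_prop

lemma ang_sq {f : R2 → ℝ} (hf : ContDiff ℝ 1 f) (hp : PerZ f) {r : ℝ} (_hr : 0 < r) :
    ∫⁻ θ in Set.Ioo (-π) π, Gd f ![r * cos θ, r * sin θ] ≤
      ENNReal.ofReal (r ^ 2 * (2 * π * ∫ x in cube, gradNormSq f x)) := by
  have hb : ∀ θ x, (fderiv ℝ f x ![r * cos θ, r * sin θ]) ^ 2 ≤ r ^ 2 * gradNormSq f x := by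
    intro θ x
    rw [fderiv_pv, gradNormSq_eq]
    set a := fderiv ℝ f x (Pi.single 0 1)
    set b := fderiv ℝ f x (Pi.single 1 1)
    have h1 := sin_sq_add_cos_sq θ
    have : r ^ 2 * (a ^ 2 + b ^ 2) - (a * (r * cos θ) + b * (r * sin θ)) ^ 2 =
      (r * (a * sin θ - b * cos θ)) ^ 2 + r ^ 2 * (a ^ 2 + b ^ 2) * (1 - (sin θ ^ 2 + cos θ ^ 2)) := by
      ring
    rw [h1] at this
    nlinarith [sq_nonneg (r * (a * sin θ - b * cos θ))]
  have h1 : ∀ θ, Gd f ![r * cos θ, r * sin θ] ≤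
      ENNReal.ofReal (r ^ 2 * ∫ x in cube, gradNormSq f x) := by
    intro θ
    refine (diff_convex hf hp (Even.convexOn_pow even_two) (by fun_prop)
      (fun t => sq_nonneg t) _).trans ?_
    rw [← integral_const_mul, ofReal_integral_eq_lintegral_ofReal
      ((cont_int (cont_gradNormSq hf)).const_mul _)
      (Eventually.of_forall fun x => mul_nonneg (sq_nonneg _) (gradNormSq_nonneg _ _))]
    exact lintegral_mono fun x => ENNReal.ofReal_le_ofReal (hb θ x)
  calc _ ≤ ∫⁻ θ in Set.Ioo (-π) π, ENNReal.ofReal (r ^ 2 * ∫ x in cube, gradNormSq f x) :=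
        lintegral_mono h1
    _ = _ := by
      rw [setLIntegral_const, Real.volume_Ioo, ← ENNReal.ofReal_mul]
      · congr 1; ring
      · exact mul_nonneg (sq_nonneg _) (integral_nonneg fun x => gradNormSq_nonneg _ _)

lemma ang_tail {f : R2 → ℝ} (h1 : ∀ x, |f x| ≤ 1) (r : ℝ) :
    ∫⁻ θ in Set.Ioo (-π) π, Gd f ![r * cos θ, r * sin θ] ≤ ENNReal.ofReal (8 * π) := by
  have hb : ∀ z, Gd f z ≤ ENNReal.ofReal 4 := by
    intro z
    calc _ ≤ ∫⁻ x in cube, ENNReal.ofReal 4 := by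
          apply lintegral_mono fun x => ENNReal.ofReal_le_ofReal ?_
          have a := abs_le.1 (h1 x); have b := abs_le.1 (h1 (x + z))
          nlinarith
      _ = _ := by simp
  calc _ ≤ ∫⁻ θ in Set.Ioo (-π) π, ENNReal.ofReal 4 := lintegral_mono fun _ => hb _
    _ = _ := by
      rw [setLIntegral_const, Real.volume_Ioo, ← ENNReal.ofReal_mul (by norm_num)]
      congr 1; ring

lemma ang_abs {f : R2 → ℝ} (hf : ContDiff ℝ 1 f) (hp : PerZ f) (h1 : ∀ x, |f x| ≤ 1)
    {r : ℝ} (hr : 0 < r) :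
    ∫⁻ θ in Set.Ioo (-π) π, Gd f ![r * cos θ, r * sin θ] ≤
      ENNReal.ofReal (r * (8 * ∫ x in cube, gradNorm f x)) := by
  have hb : ∀ z, Gd f z ≤ ENNReal.ofReal 2 * ∫⁻ x in cube, ENNReal.ofReal |fderiv ℝ f x z| := by
    intro z
    calc _ ≤ ∫⁻ x in cube, ENNReal.ofReal 2 * ENNReal.ofReal |f (x + z) - f x| := by
          apply lintegral_mono fun x => ?_
          rw [← ENNReal.ofReal_mul (by norm_num)]
          apply ENNReal.ofReal_le_ofReal
          have a := abs_le.1 (h1 x); have b := abs_le.1 (h1 (x + z))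
          rw [← sq_abs, sq]
          apply mul_le_mul_of_nonneg_right _ (abs_nonneg _)
          rw [abs_le]; constructor <;> linarith
      _ = ENNReal.ofReal 2 * ∫⁻ x in cube, ENNReal.ofReal |f (x + z) - f x| := by
          rw [lintegral_const_mul' _ _ ENNReal.ofReal_ne_top]
      _ ≤ _ := by
          refine mul_le_mul_right ?_ _
          exact diff_convex hf hp (convexOn_univ_norm (E := ℝ)) continuous_abs (fun t => abs_nonneg t) z
  calc _ ≤ ∫⁻ θ in Set.Ioo (-π) π, ENNReal.ofReal 2 *
          ∫⁻ x in cube, ENNReal.ofReal |fderiv ℝ f x ![r * cos θ, r * sin θ]| :=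
        lintegral_mono fun _ => hb _
    _ = ENNReal.ofReal 2 * ∫⁻ x in cube, ∫⁻ θ in Set.Ioo (-π) π,
          ENNReal.ofReal |fderiv ℝ f x ![r * cos θ, r * sin θ]| := by
        rw [lintegral_const_mul' _ _ ENNReal.ofReal_ne_top, lintegral_lintegral_swap]
        exact (meas_fderiv_pv hf continuous_abs r).aemeasurable
    _ = ENNReal.ofReal 2 * ∫⁻ x in cube, ENNReal.ofReal (4 * r * gradNorm f x) := by
        congr 1
        apply lintegral_congr fun x => ?_
        have : ∀ θ, |fderiv ℝ f x ![r * cos θ, r * sin θ]| =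
            |(r * fderiv ℝ f x (Pi.single 0 1)) * cos θ +
              (r * fderiv ℝ f x (Pi.single 1 1)) * sin θ| := by
          intro θ; rw [fderiv_pv]; congr 1; ring
        simp_rw [this]
        rw [lint_abs_trig, gradNorm, gradNormSq_eq, mul_pow, mul_pow, ← mul_add,
          sqrt_mul (sq_nonneg r), sqrt_sq hr.le, mul_assoc]
    _ = _ := by
        rw [← ofReal_integral_eq_lintegral_ofReal ((cont_int (cont_gradNorm hf)).const_mul _)
          (Eventually.of_forall fun x => mul_nonneg (by positivity) (sqrt_nonneg _)),
          ← ENNReal.ofReal_mul (by norm_num), integral_const_mul]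
        congr 1; ring

lemma meas_Gd {f : R2 → ℝ} (hf : Continuous f) : Measurable (Gd f) := by
  unfold Gd
  apply Measurable.lintegral_prod_right' (f := fun p : R2 × R2 =>
    ENNReal.ofReal ((f (p.2 + p.1) - f p.2) ^ 2))
  apply ENNReal.measurable_ofReal.comp
  apply Continuous.measurable
  fun_prop

lemma cont_en2 : Continuous en2 := by
  unfold en2; fun_prop

lemma en2_pv {r : ℝ} (hr : 0 < r) (θ : ℝ) : en2 ![r * cos θ, r * sin θ] = r := by
  simp only [en2, Fin.sum_univ_two, Matrix.cons_val_zero, Matrix.cons_val_one]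
  have : (r * cos θ) ^ 2 + (r * sin θ) ^ 2 = r ^ 2 := by
    have := sin_sq_add_cos_sq θ
    calc _ = r ^ 2 * (sin θ ^ 2 + cos θ ^ 2) := by ring
      _ = _ := by rw [this, mul_one]
  rw [this, sqrt_sq hr.le]

lemma lint_H {f : R2 → ℝ} (hf : ContDiff ℝ 1 f) (hp : PerZ f) (h1 : ∀ x, |f x| ≤ 1)
    {ε R : ℝ} (hε : 0 < ε) (hR : ε ≤ R) :
    ∫⁻ x in cube, ∫⁻ z : R2, ENNReal.ofReal ((f (x + z) - f x) ^ 2 / en2 z ^ 3) ≤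
      ENNReal.ofReal (ε * (2 * π * ∫ x in cube, gradNormSq f x) +
        log (R / ε) * (8 * ∫ x in cube, gradNorm f x) + 8 * π / R) := by
  have hR0 : 0 < R := hε.trans_le hR
  set A := 2 * π * ∫ x in cube, gradNormSq f x with hA
  set B := 8 * ∫ x in cube, gradNorm f x with hB
  have hA0 : 0 ≤ A := by
    have : 0 ≤ ∫ x in cube, gradNormSq f x := integral_nonneg fun x => gradNormSq_nonneg _ _
    positivity
  have hB0 : 0 ≤ B := by
    have : 0 ≤ ∫ x in cube, gradNorm f x := integral_nonneg fun x => sqrt_nonneg _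
    positivity
  have hcf := hf.continuous
  have hce := cont_en2
  rw [lintegral_lintegral_swap]
  swap
  · apply Measurable.aemeasurable
    apply ENNReal.measurable_ofReal.comp
    apply Measurable.div
    · apply Continuous.measurable; fun_prop
    · apply Continuous.measurable; fun_prop
  have e1 : ∀ z : R2, ∫⁻ x in cube, ENNReal.ofReal ((f (x + z) - f x) ^ 2 / en2 z ^ 3) =
      ENNReal.ofReal ((en2 z ^ 3)⁻¹) * Gd f z := by
    intro z
    unfold Gd
    rw [← lintegral_const_mul' _ _ ENNReal.ofReal_ne_top]
    apply lintegral_congr fun x => ?_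
    rw [← ENNReal.ofReal_mul, div_eq_inv_mul]
    have : 0 ≤ en2 z := sqrt_nonneg _
    positivity
  simp_rw [e1]
  rw [polar_lint]
  swap
  · exact (ENNReal.measurable_ofReal.comp (by
      apply Measurable.inv; apply Continuous.measurable; fun_prop)).mul (meas_Gd hcf)
  set J : ℝ → ENNReal := fun r => ∫⁻ θ in Set.Ioo (-π) π, Gd f ![r * cos θ, r * sin θ] with hJ
  have e2 : ∫⁻ r in Set.Ioi (0 : ℝ), ∫⁻ θ in Set.Ioo (-π) π,
      ENNReal.ofReal r * (ENNReal.ofReal ((en2 ![r * cos θ, r * sin θ] ^ 3)⁻¹) *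
        Gd f ![r * cos θ, r * sin θ]) = ∫⁻ r in Set.Ioi (0 : ℝ), ENNReal.ofReal ((r ^ 2)⁻¹) * J r := by
    apply setLIntegral_congr_fun measurableSet_Ioi
    intro r hr
    have hr : 0 < r := hr
    simp only [hJ]
    rw [← lintegral_const_mul' _ _ ENNReal.ofReal_ne_top]
    apply lintegral_congr fun θ => ?_
    rw [en2_pv hr, ← mul_assoc, ← ENNReal.ofReal_mul hr.le]
    congr 2
    field_simp
  rw [e2]
  have hs : Set.Ioi (0 : ℝ) = (Set.Ioc 0 ε ∪ Set.Ioc ε R) ∪ Set.Ioi R := by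
    rw [Set.Ioc_union_Ioc_eq_Ioc hε.le hR, Set.Ioc_union_Ioi_eq_Ioi hR0.le]
  have b1 : ∫⁻ r in Set.Ioc 0 ε, ENNReal.ofReal ((r ^ 2)⁻¹) * J r ≤ ENNReal.ofReal (ε * A) := by
    calc _ ≤ ∫⁻ r in Set.Ioc 0 ε, ENNReal.ofReal A := by
          apply setLIntegral_mono' measurableSet_Ioc
          intro r hr
          have := ang_sq hf hp hr.1
          calc _ ≤ ENNReal.ofReal ((r ^ 2)⁻¹) * ENNReal.ofReal (r ^ 2 * A) := by gcongr
            _ = _ := by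
              have := hr.1
              rw [← ENNReal.ofReal_mul (by positivity)]; congr 1; field_simp
      _ = _ := by
          rw [setLIntegral_const, Real.volume_Ioc, ← ENNReal.ofReal_mul hA0]; congr 1; ring
  have b2 : ∫⁻ r in Set.Ioc ε R, ENNReal.ofReal ((r ^ 2)⁻¹) * J r ≤
      ENNReal.ofReal (log (R / ε) * B) := by
    calc _ ≤ ∫⁻ r in Set.Ioc ε R, ENNReal.ofReal (r⁻¹ * B) := by
          apply setLIntegral_mono' measurableSet_Ioc
          intro r hr
          have hr0 : 0 < r := hε.trans hr.1
          have := ang_abs hf hp h1 hr0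
          calc _ ≤ ENNReal.ofReal ((r ^ 2)⁻¹) * ENNReal.ofReal (r * B) := by gcongr
            _ = _ := by
              rw [← ENNReal.ofReal_mul (by positivity)]; congr 1; field_simp
      _ = _ := by
          have hcont : ContinuousOn (fun r : ℝ => r⁻¹ * B) (Set.Icc ε R) :=
            (continuousOn_id.inv₀ (fun r hr => (hε.trans_le hr.1).ne')).mul continuousOn_const
          rw [← ofReal_integral_eq_lintegral_ofReal]
          · rw [← intervalIntegral.integral_of_le hR, intervalIntegral.integral_mul_const,
              integral_inv_of_pos hε hR0]
          · exact (hcont.integrableOn_compact isCompact_Icc).mono_set Set.Ioc_subset_Icc_self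
          · filter_upwards [self_mem_ae_restrict measurableSet_Ioc] with r hr
            have hr0 : 0 < r := hε.trans hr.1
            exact mul_nonneg (inv_nonneg.2 hr0.le) hB0
  have b3 : ∫⁻ r in Set.Ioi R, ENNReal.ofReal ((r ^ 2)⁻¹) * J r ≤ ENNReal.ofReal (8 * π / R) := by
    have heq : ∀ r ∈ Set.Ioi R, (r ^ 2)⁻¹ * (8 * π) = r ^ (-2 : ℝ) * (8 * π) := by
      intro r hr
      have hr0 : 0 < r := hR0.trans hr
      rw [rpow_neg hr0.le]; norm_num
    have hIntg : IntegrableOn (fun r : ℝ => r ^ (-2 : ℝ) * (8 * π)) (Set.Ioi R) :=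
      (integrableOn_Ioi_rpow_of_lt (by norm_num) hR0).mul_const _
    calc _ ≤ ∫⁻ r in Set.Ioi R, ENNReal.ofReal (r ^ (-2 : ℝ) * (8 * π)) := by
          apply setLIntegral_mono' measurableSet_Ioi
          intro r hr
          have := ang_tail h1 r
          calc _ ≤ ENNReal.ofReal ((r ^ 2)⁻¹) * ENNReal.ofReal (8 * π) := by gcongr
            _ = _ := by
              rw [← ENNReal.ofReal_mul (by positivity), heq r hr]
      _ = _ := by
          rw [← ofReal_integral_eq_lintegral_ofReal hIntg]
          · rw [integral_mul_const, integral_Ioi_rpow_of_lt (by norm_num) hR0]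
            congr 1
            norm_num [rpow_neg hR0.le]
            field_simp
          · filter_upwards [self_mem_ae_restrict measurableSet_Ioi] with r hr
            have hr0 : 0 < r := hR0.trans hr
            show 0 ≤ r ^ (-2 : ℝ) * (8 * π)
            positivity
  have hlog : 0 ≤ log (R / ε) := log_nonneg ((one_le_div hε).2 hR)
  rw [hs, ENNReal.ofReal_add (by positivity) (by positivity),
    ENNReal.ofReal_add (by positivity) (by positivity)]
  refine (lintegral_union_le _ _ _).trans (add_le_add ?_ b3)
  exact (lintegral_union_le _ _ _).trans (add_le_add b1 b2)

lemma int_le_of_lint {X : Type*} [MeasurableSpace X] {μ : Measure X} {g : X → ℝ} {B : ℝ}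
    (hg : ∀ x, 0 ≤ g x) (hB : 0 ≤ B) (h : ∫⁻ x, ENNReal.ofReal (g x) ∂μ ≤ ENNReal.ofReal B) :
    ∫ x, g x ∂μ ≤ B := by
  by_cases hi : Integrable g μ
  · rw [← ofReal_integral_eq_lintegral_ofReal hi (Eventually.of_forall hg)] at h
    exact (ENNReal.ofReal_le_ofReal_iff hB).1 h
  · rw [integral_undef hi]; exact hB

lemma H12_bound {f : R2 → ℝ} (hf : ContDiff ℝ 1 f) (hp : PerZ f) (h1 : ∀ x, |f x| ≤ 1)
    {ε R : ℝ} (hε : 0 < ε) (hR : ε ≤ R) :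
    H12 f ≤ (1 / (4 * π)) * (ε * (2 * π * ∫ x in cube, gradNormSq f x) +
        log (R / ε) * (8 * ∫ x in cube, gradNorm f x) + 8 * π / R) := by
  unfold H12
  apply mul_le_mul_of_nonneg_left _ (by positivity)
  have hn : ∀ x z : R2, 0 ≤ (f (x + z) - f x) ^ 2 / en2 z ^ 3 := fun x z => by
    have : 0 ≤ en2 z := sqrt_nonneg _
    positivity
  apply int_le_of_lint (fun x => integral_nonneg (hn x))
  · have hR0 : 0 < R := hε.trans_le hR
    have hlog : 0 ≤ log (R / ε) := log_nonneg ((one_le_div hε).2 hR)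
    have : 0 ≤ ∫ x in cube, gradNormSq f x := integral_nonneg fun x => gradNormSq_nonneg _ _
    have : 0 ≤ ∫ x in cube, gradNorm f x := integral_nonneg fun x => sqrt_nonneg _
    positivity
  · refine le_trans (lintegral_mono fun x => ?_) (lint_H hf hp h1 hε hR)
    by_cases hi : Integrable (fun z => (f (x + z) - f x) ^ 2 / en2 z ^ 3)
    · rw [ofReal_integral_eq_lintegral_ofReal hi (Eventually.of_forall (hn x))]
    · rw [integral_undef hi]; simp

lemma mag_contDiff {m : R2 → R3} (hm : Mag m) (i : Fin 3) : ContDiff ℝ 1 (fun x => m x i) :=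
  contDiff_pi.1 hm.1 i

lemma mag_per {m : R2 → R3} (hm : Mag m) (i : Fin 3) : PerZ (fun x => m x i) := by
  intro x n
  simp only [hm.2.1 x n]

lemma mag_abs {m : R2 → R3} (hm : Mag m) (x : R2) : |m x 2| ≤ 1 := by
  have := hm.2.2 x
  rw [Fin.sum_univ_three] at this
  rw [abs_le_one_iff_mul_self_le_one]
  nlinarith [sq_nonneg (m x 0), sq_nonneg (m x 1)]

lemma fderiv_comp_eq {m : R2 → R3} (hm : Mag m) (i : Fin 3) (x v : R2) :
    fderiv ℝ (fun x => m x i) x v = fderiv ℝ m x v i := by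
  have hd : DifferentiableAt ℝ m x := hm.1.differentiable one_ne_zero x
  have h := (hasFDerivAt_pi'.1 hd.hasFDerivAt i).fderiv
  rw [h]; rfl

lemma mag_orth {m : R2 → R3} (hm : Mag m) (x v : R2) :
    m x 0 * fderiv ℝ m x v 0 + m x 1 * fderiv ℝ m x v 1 + m x 2 * fderiv ℝ m x v 2 = 0 := by
  have hd : ∀ i, HasFDerivAt (fun x => m x i) (fderiv ℝ (fun x => m x i) x) x := fun i =>
    ((mag_contDiff hm i).differentiable one_ne_zero x).hasFDerivAt
  have h := (((hd 0).pow 2).add ((hd 1).pow 2)).add ((hd 2).pow 2)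
  have hc : (fun x => m x 0 ^ 2 + m x 1 ^ 2 + m x 2 ^ 2) = fun _ => (1 : ℝ) := by
    funext y
    have := hm.2.2 y
    rwa [Fin.sum_univ_three] at this
  have h2 := h.congr_of_eventuallyEq (f₁ := fun _ => (1 : ℝ))
    (Eventually.of_forall fun y => (congrFun hc y).symm)
  have h3 := h2.unique (hasFDerivAt_const (1 : ℝ) x)
  have h4 := congrArg (fun (L : R2 →L[ℝ] ℝ) => L v) h3
  simp [fderiv_comp_eq hm] at h4
  linarith

lemma grad_le {m : R2 → R3} (hm : Mag m) (x : R2) :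
    gradNormSq (fun x => m x 2) x ≤ (1 - (m x 2) ^ 2) * gradVSq m x := by
  unfold gradNormSq gradVSq
  rw [Finset.mul_sum]
  apply Finset.sum_le_sum
  intro j _
  rw [fderiv_comp_eq hm, Fin.sum_univ_three]
  have h1 := mag_orth hm x (Pi.single j 1)
  have h2 := hm.2.2 x
  rw [Fin.sum_univ_three] at h2
  set a := m x 0
  set b := m x 1
  set c := m x 2
  set p := fderiv ℝ m x (Pi.single j 1) 0
  set q := fderiv ℝ m x (Pi.single j 1) 1
  set r := fderiv ℝ m x (Pi.single j 1) 2
  have h3 : (c * r) ^ 2 = (a * p + b * q) ^ 2 := by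
    have : c * r = -(a * p + b * q) := by linarith
    rw [this]; ring
  have h4 : 1 - c ^ 2 = a ^ 2 + b ^ 2 := by linarith
  have h5 : r ^ 2 = (a ^ 2 + b ^ 2) * r ^ 2 + (c * r) ^ 2 := by
    rw [← h4]; ring
  rw [h4, h5, h3]
  nlinarith [sq_nonneg (a * q - b * p)]

/-- The local part of the energy density. -/
def eloc (ε : ℝ) (m : R2 → R3) (x : R2) : ℝ :=
  ε / 2 * gradVSq m x + (1 - (m x 2) ^ 2) / (2 * ε)

lemma gradVSq_nonneg (m : R2 → R3) (x : R2) : 0 ≤ gradVSq m x :=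
  Finset.sum_nonneg fun _ _ => Finset.sum_nonneg fun _ _ => sq_nonneg _

lemma cont_eloc (ε : ℝ) {m : R2 → R3} (hm : Mag m) : Continuous (eloc ε m) := by
  have hcf := hm.1.continuous_fderiv one_ne_zero
  have hc := hm.1.continuous
  have : Continuous (gradVSq m) := by
    unfold gradVSq
    refine continuous_finsetSum _ fun j _ => continuous_finsetSum _ fun i _ => ?_
    have h2 : Continuous fun x => fderiv ℝ m x (Pi.single j 1) := by fun_prop
    exact ((continuous_apply i).comp h2).pow 2
  unfold eloc
  fun_prop

lemma one_sub_nonneg {m : R2 → R3} (hm : Mag m) (x : R2) : 0 ≤ 1 - (m x 2) ^ 2 := by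
  have := mag_abs hm x
  have := abs_le.1 this
  nlinarith

lemma gradNorm_le_eloc {ε : ℝ} (hε : 0 < ε) {m : R2 → R3} (hm : Mag m) (x : R2) :
    gradNorm (fun x => m x 2) x ≤ eloc ε m x := by
  have h := grad_le hm x
  have hP := gradVSq_nonneg m x
  have hQ := one_sub_nonneg hm x
  unfold gradNorm eloc
  apply sqrt_le_iff.2
  constructor
  · positivity
  · refine h.trans ?_
    have : (ε / 2 * gradVSq m x + (1 - m x 2 ^ 2) / (2 * ε)) ^ 2 - (1 - m x 2 ^ 2) * gradVSq m x
        = (ε / 2 * gradVSq m x - (1 - m x 2 ^ 2) / (2 * ε)) ^ 2 := by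
      field_simp; ring
    nlinarith [sq_nonneg (ε / 2 * gradVSq m x - (1 - m x 2 ^ 2) / (2 * ε))]

lemma eps_gradNormSq_le_eloc {ε : ℝ} (hε : 0 < ε) {m : R2 → R3} (hm : Mag m) (x : R2) :
    ε / 2 * gradNormSq (fun x => m x 2) x ≤ eloc ε m x := by
  have h := grad_le hm x
  have hP := gradVSq_nonneg m x
  have hQ := one_sub_nonneg hm x
  unfold eloc
  have h1 : gradNormSq (fun x => m x 2) x ≤ gradVSq m x := by
    nlinarith [mul_nonneg (sq_nonneg (m x 2)) hP]
  have : 0 ≤ (1 - m x 2 ^ 2) / (2 * ε) := by positivity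
  nlinarith

lemma energy_bound {C ε : ℝ} (hε : 0 < ε) (hL : 3 ≤ -log ε) {m : R2 → R3} (hm : Mag m)
    (hF : Fen ε (π / 2) m ≤ C / |log ε|) :
    ∫ x in cube, eloc ε m x ≤ C + π * exp 3 := by
  set L := -log ε with hLd
  have habs : |log ε| = L := by rw [abs_of_nonpos (by linarith)]
  have hεR : ε ≤ exp (-3) := by
    rw [← exp_log hε]; exact exp_le_exp.2 (by linarith)
  have hH := H12_bound (mag_contDiff hm 2) (mag_per hm 2) (mag_abs hm) hε hεR
  set E := ∫ x in cube, eloc ε m x with hE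
  set V := ∫ x in cube, gradNorm (fun x => m x 2) x with hV
  set D := ∫ x in cube, gradNormSq (fun x => m x 2) x with hD
  have hVE : V ≤ E := integral_mono (cont_int (cont_gradNorm (mag_contDiff hm 2)))
    (cont_int (cont_eloc ε hm)) (gradNorm_le_eloc hε hm)
  have hDE : ε / 2 * D ≤ E := by
    rw [hD, ← integral_const_mul]
    exact integral_mono ((cont_int (cont_gradNormSq (mag_contDiff hm 2))).const_mul _)
      (cont_int (cont_eloc ε hm)) (eps_gradNormSq_le_eloc hε hm)
  have hE0 : 0 ≤ E := by
    have : 0 ≤ V := integral_nonneg fun x => sqrt_nonneg _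
    linarith
  have hlog : log (exp (-3) / ε) = L - 3 := by
    rw [log_div (exp_pos _).ne' hε.ne', log_exp]; ring
  rw [hlog] at hH
  have hF' : E - π / 2 / L * H12 (fun x => m x 2) ≤ C / L := by
    rw [habs] at hF
    have := hF
    unfold Fen at this
    rw [habs] at this
    exact this
  have hL0 : 0 < L := by linarith
  have h1 : E * L - π / 2 * H12 (fun x => m x 2) ≤ C := by
    have := mul_le_mul_of_nonneg_right hF' hL0.le
    have e1 : (E - π / 2 / L * H12 (fun x => m x 2)) * L = E * L - π / 2 * H12 (fun x => m x 2) := by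
      field_simp
    have e2 : C / L * L = C := by field_simp
    rwa [e1, e2] at this
  have h2 : π / 2 * H12 (fun x => m x 2) ≤ π / 2 * (ε / 2 * D) + V * (L - 3) + π * exp 3 := by
    have := mul_le_mul_of_nonneg_left hH (by positivity : 0 ≤ π / 2)
    refine this.trans (le_of_eq ?_)
    have : exp (-3) = (exp 3)⁻¹ := exp_neg 3
    rw [this]
    have := exp_pos (3 : ℝ)
    field_simp
    ring
  have h3 : π / 2 * (ε / 2 * D) ≤ 2 * E := by
    have := pi_le_four
    have hp := pi_pos
    nlinarith
  have h4 : V * (L - 3) ≤ E * (L - 3) := mul_le_mul_of_nonneg_right hVE (by linarith)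
  nlinarith

/-- Small squares of side `1/n`. -/
def Qn (n : ℕ) (j : Fin 2 → Fin n) : Set R2 :=
  Set.univ.pi fun i => Set.Ico (((j i : ℕ) : ℝ) / n) ((((j i : ℕ) : ℝ) + 1) / n)

lemma meas_Qn (n : ℕ) (j : Fin 2 → Fin n) : MeasurableSet (Qn n j) :=
  MeasurableSet.univ_pi fun _ => measurableSet_Ico

lemma vol_Qn {n : ℕ} (hn : 0 < n) (j : Fin 2 → Fin n) :
    volume (Qn n j) = ENNReal.ofReal (((n : ℝ) ^ 2)⁻¹) := by
  have hn' : (0 : ℝ) < n := by exact_mod_cast hn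
  have h : ∀ a : ℝ, (a + 1) / n - a / n = (n : ℝ)⁻¹ := by intro a; field_simp; ring
  simp only [Qn, volume_pi_pi, Real.volume_Ico, h, Fin.prod_univ_two]
  rw [← ENNReal.ofReal_mul (by positivity)]
  congr 1; field_simp

lemma iUnion_Qn {n : ℕ} (hn : 0 < n) : ⋃ j, Qn n j = cube := by
  have hn' : (0 : ℝ) < n := by exact_mod_cast hn
  ext x
  simp only [Set.mem_iUnion, Qn, cube, Set.mem_pi, Set.mem_univ, true_implies, Set.mem_Ico]
  constructor
  · rintro ⟨j, hj⟩ i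
    obtain ⟨h1, h2⟩ := hj i
    refine ⟨le_trans (by positivity) h1, h2.trans_le ?_⟩
    rw [div_le_one hn']
    exact_mod_cast (j i).2
  · intro h
    have hlt : ∀ i, ⌊(n : ℝ) * x i⌋₊ < n := by
      intro i
      rw [Nat.floor_lt (mul_nonneg hn'.le (h i).1)]
      nlinarith [(h i).2]
    refine ⟨fun i => ⟨⌊(n : ℝ) * x i⌋₊, hlt i⟩, fun i => ⟨?_, ?_⟩⟩
    · rw [div_le_iff₀ hn']
      have := Nat.floor_le (mul_nonneg hn'.le (h i).1)
      simp only; linarith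
    · rw [lt_div_iff₀ hn']
      have := Nat.lt_floor_add_one ((n : ℝ) * x i)
      simp only; linarith

lemma disj_Qn {n : ℕ} (hn : 0 < n) : Pairwise (Function.onFun Disjoint (Qn n)) := by
  have hn' : (0 : ℝ) < n := by exact_mod_cast hn
  intro j j' hjj
  rw [Function.onFun, Set.disjoint_left]
  intro x hx hx'
  apply hjj
  simp only [Qn, Set.mem_pi, Set.mem_univ, true_implies, Set.mem_Ico, div_le_iff₀ hn',
    lt_div_iff₀ hn'] at hx hx'
  funext i
  have a := hx i
  have b := hx' i
  have h1 : ((j i : ℕ) : ℝ) < (j' i : ℕ) + 1 := by linarith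
  have h2 : ((j' i : ℕ) : ℝ) < (j i : ℕ) + 1 := by linarith
  have h1' : (j i : ℕ) < (j' i : ℕ) + 1 := by exact_mod_cast h1
  have h2' : (j' i : ℕ) < (j i : ℕ) + 1 := by exact_mod_cast h2
  apply Fin.ext; omega

lemma sum_Qn {n : ℕ} (hn : 0 < n) (g : R2 → ENNReal) :
    ∑ j, ∫⁻ x in Qn n j, g x = ∫⁻ x in cube, g x := by
  rw [← iUnion_Qn hn, lintegral_iUnion (meas_Qn n) (disj_Qn hn), tsum_fintype]

/-- The box of differences of points in a small square. -/
def Bn (n : ℕ) : Set R2 := Set.univ.pi fun _ => Set.Icc (-(n : ℝ)⁻¹) ((n : ℝ)⁻¹)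

lemma meas_Bn (n : ℕ) : MeasurableSet (Bn n) := MeasurableSet.univ_pi fun _ => measurableSet_Icc

lemma vol_Bn {n : ℕ} (hn : 0 < n) : volume (Bn n) = ENNReal.ofReal (4 * ((n : ℝ) ^ 2)⁻¹) := by
  have hn' : (0 : ℝ) < n := by exact_mod_cast hn
  simp only [Bn, volume_pi_pi, Real.volume_Icc, Fin.prod_univ_two]
  rw [← ENNReal.ofReal_mul (by have := inv_pos.2 hn'; linarith)]
  congr 1; field_simp; ring

lemma fderiv_abs_le (f : R2 → ℝ) (x z : R2) : |fderiv ℝ f x z| ≤ en2 z * gradNorm f x := by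
  have hz : z = ![z 0, z 1] := by ext i; fin_cases i <;> rfl
  conv_lhs => rw [hz]
  rw [fderiv_pv, gradNorm, gradNormSq_eq, en2, Fin.sum_univ_two, ← sqrt_mul (by positivity)]
  apply abs_le_sqrt
  nlinarith [sq_nonneg (fderiv ℝ f x (Pi.single 0 1) * z 1 - fderiv ℝ f x (Pi.single 1 1) * z 0)]

lemma shift_V {f : R2 → ℝ} (hf : ContDiff ℝ 1 f) (hp : PerZ f) (z : R2) :
    ∫⁻ x in cube, ENNReal.ofReal |f (x + z) - f x| ≤
      ENNReal.ofReal (en2 z * ∫ x in cube, gradNorm f x) := by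
  refine (diff_convex hf hp (convexOn_univ_norm (E := ℝ)) continuous_abs
    (fun t => abs_nonneg t) z).trans ?_
  rw [← integral_const_mul, ofReal_integral_eq_lintegral_ofReal
    (f := fun x => en2 z * gradNorm f x) ((cont_int (cont_gradNorm hf)).const_mul _)
    (Eventually.of_forall fun x => mul_nonneg (sqrt_nonneg _) (sqrt_nonneg _))]
  exact lintegral_mono fun x => ENNReal.ofReal_le_ofReal (fderiv_abs_le f x z)

lemma approx {f : R2 → ℝ} (hf : ContDiff ℝ 1 f) (hp : PerZ f) (h1 : ∀ x, |f x| ≤ 1)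
    {n : ℕ} (hn : 0 < n) :
    ∃ c : (Fin 2 → Fin n) → ℝ, (∀ j, |c j| ≤ 1) ∧
      ∑ j, ∫⁻ x in Qn n j, ENNReal.ofReal |f x - c j| ≤
        ENNReal.ofReal (8 * (∫ x in cube, gradNorm f x) / n) := by
  have hn' : (0 : ℝ) < n := by exact_mod_cast hn
  have hcf := hf.continuous
  have hcont : Continuous fun p : R2 × R2 => |f p.2 - f p.1| := by fun_prop
  have hmeas : ∀ s : Set R2, Measurable fun y => ∫⁻ x in s, ENNReal.ofReal |f x - f y| := fun s =>
    Measurable.lintegral_prod_right' (f := fun p : R2 × R2 => ENNReal.ofReal |f p.2 - f p.1|)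
      (ENNReal.measurable_ofReal.comp hcont.measurable)
  have hex : ∀ j, ∃ y ∈ Qn n j, ∫⁻ x in Qn n j, ENNReal.ofReal |f x - f y| ≤
      ENNReal.ofReal ((n : ℝ) ^ 2) *
        ∫⁻ y in Qn n j, ∫⁻ z in Bn n, ENNReal.ofReal |f (y + z) - f y| := by
    intro j
    have hv := vol_Qn hn j
    obtain ⟨y, hy, hle⟩ := exists_le_setLAverage (μ := volume) (s := Qn n j)
      (f := fun y => ∫⁻ x in Qn n j, ENNReal.ofReal |f x - f y|)
      (by rw [hv]; exact (ENNReal.ofReal_pos.2 (by positivity)).ne')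
      (by rw [hv]; exact ENNReal.ofReal_ne_top) (hmeas _).aemeasurable
    refine ⟨y, hy, hle.trans ?_⟩
    rw [setLAverage_eq, hv, ENNReal.div_eq_inv_mul, ← ENNReal.ofReal_inv_of_pos (by positivity),
      inv_inv]
    refine mul_le_mul_right ?_ _
    apply setLIntegral_mono' (meas_Qn n j)
    intro y hy
    rw [← lintegral_indicator (meas_Qn n j), ← lintegral_indicator (meas_Bn n),
      ← lintegral_add_left_eq_self _ y]
    apply lintegral_mono fun z => ?_
    by_cases hz : y + z ∈ Qn n j
    · have hzB : z ∈ Bn n := by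
        simp only [Qn, Bn, Set.mem_pi, Set.mem_univ, true_implies, Set.mem_Ico, Set.mem_Icc,
          add_div] at hy hz ⊢
        intro i
        have a := hy i
        have b := hz i
        simp only [Pi.add_apply, one_div] at a b
        constructor <;> linarith
      simp only [Set.indicator_of_mem hz, Set.indicator_of_mem hzB, le_refl]
    · simp only [Set.indicator_of_notMem hz]; exact zero_le
  choose y hy hle using hex
  refine ⟨fun j => f (y j), fun j => h1 _, ?_⟩
  set V := ∫ x in cube, gradNorm f x with hV
  have hV0 : 0 ≤ V := integral_nonneg fun x => sqrt_nonneg _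
  calc _ ≤ ∑ j, ENNReal.ofReal ((n : ℝ) ^ 2) *
        ∫⁻ y in Qn n j, ∫⁻ z in Bn n, ENNReal.ofReal |f (y + z) - f y| :=
        Finset.sum_le_sum fun j _ => hle j
    _ = ENNReal.ofReal ((n : ℝ) ^ 2) *
        ∫⁻ z in Bn n, ∫⁻ y in cube, ENNReal.ofReal |f (y + z) - f y| := by
        rw [← Finset.mul_sum, sum_Qn hn, lintegral_lintegral_swap]
        have : Continuous (Function.uncurry fun (y z : R2) => |f (y + z) - f y|) := by
          simp only [Function.uncurry_def]; fun_prop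
        exact (ENNReal.measurable_ofReal.comp this.measurable).aemeasurable
    _ ≤ ENNReal.ofReal ((n : ℝ) ^ 2) * ∫⁻ z in Bn n, ENNReal.ofReal (2 / n * V) := by
        refine mul_le_mul_right ?_ _
        apply setLIntegral_mono' (meas_Bn n)
        intro z hz
        refine (shift_V hf hp z).trans (ENNReal.ofReal_le_ofReal ?_)
        apply mul_le_mul_of_nonneg_right _ hV0
        rw [en2, Fin.sum_univ_two]
        apply sqrt_le_iff.2
        refine ⟨by positivity, ?_⟩
        simp only [Bn, Set.mem_pi, Set.mem_univ, true_implies, Set.mem_Icc] at hz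
        have a := hz 0
        have b := hz 1
        have hi := inv_pos.2 hn'
        rw [div_eq_mul_inv]
        nlinarith
    _ = _ := by
        rw [setLIntegral_const, vol_Bn hn, ← ENNReal.ofReal_mul (by positivity),
          ← ENNReal.ofReal_mul (by positivity)]
        congr 1; field_simp; ring

lemma compact_BV {f : ℕ → R2 → ℝ} (hf : ∀ k, ContDiff ℝ 1 (f k)) (hp : ∀ k, PerZ (f k))
    (h1 : ∀ k x, |f k x| ≤ 1) {M : ℝ} (hM : ∀ k, ∫ x in cube, gradNorm (f k) x ≤ M) :
    ∃ φ : ℕ → ℕ, StrictMono φ ∧ ∃ g : R2 → ℝ, Integrable g (volume.restrict cube) ∧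
      Tendsto (fun k => ∫ x in cube, |f (φ k) x - g x|) atTop (nhds 0) := by
  have hIntg : ∀ k, Integrable (f k) (volume.restrict cube) := fun k => cont_int (hf k).continuous
  set F : ℕ → (R2 →₁[volume.restrict cube] ℝ) := fun k => (hIntg k).toL1 (f k) with hF
  have hM0 : 0 ≤ M := le_trans (integral_nonneg fun x => sqrt_nonneg _) (hM 0)
  have htb : TotallyBounded (Set.range F) := by
    apply Metric.totallyBounded_of_finite_discretization
    intro δ hδ
    obtain ⟨n, hnδ⟩ := exists_nat_gt ((16 * M + 1) / δ)
    have hn' : (0 : ℝ) < n := lt_of_le_of_lt (by positivity) hnδ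
    have hn : 0 < n := by exact_mod_cast hn'
    choose c hc1 hc2 using fun k => approx (hf k) (hp k) (h1 k) hn
    choose κ hκ using fun p : Set.range F => p.2
    have hfl : ∀ k j, ⌊(n : ℝ) * c k j⌋ ∈ Finset.Icc (-(n : ℤ)) n := by
      intro k j
      have := abs_le.1 (hc1 k j)
      rw [Finset.mem_Icc]
      constructor
      · rw [Int.le_floor]; push_cast; nlinarith
      · apply Int.floor_le_iff.2; push_cast; nlinarith
    refine ⟨(Fin 2 → Fin n) → (Finset.Icc (-(n : ℤ)) n), inferInstance,
      fun p j => ⟨_, hfl (κ p) j⟩, ?_⟩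
    intro p q hpq
    have hcl : ∀ j, |c (κ p) j - c (κ q) j| ≤ 1 / n := by
      intro j
      have h := congrArg Subtype.val (congrFun hpq j)
      simp only at h
      have := Int.abs_sub_lt_one_of_floor_eq_floor h
      rw [← mul_sub, abs_mul, abs_of_pos hn'] at this
      rw [le_div_iff₀ hn']; linarith
    have hd : edist (p : R2 →₁[volume.restrict cube] ℝ) q ≤ ENNReal.ofReal ((16 * M + 1) / n) := by
      rw [← hκ p, ← hκ q]
      simp only [hF]
      rw [Integrable.edist_toL1_toL1]
      have hV : ∀ k, ENNReal.ofReal (8 * (∫ x in cube, gradNorm (f k) x) / n) ≤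
          ENNReal.ofReal (8 * M / n) := fun k => ENNReal.ofReal_le_ofReal (by
            have := hM k
            gcongr)
      calc _ = ∫⁻ x in cube, ENNReal.ofReal |f (κ p) x - f (κ q) x| := by
            apply lintegral_congr fun x => ?_
            rw [edist_dist, Real.dist_eq]
        _ = ∑ j, ∫⁻ x in Qn n j, ENNReal.ofReal |f (κ p) x - f (κ q) x| := (sum_Qn hn _).symm
        _ ≤ ∑ j, ((∫⁻ x in Qn n j, ENNReal.ofReal |f (κ p) x - c (κ p) j|) +
              (∫⁻ x in Qn n j, ENNReal.ofReal |f (κ q) x - c (κ q) j|) +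
              ∫⁻ x in Qn n j, ENNReal.ofReal (1 / n)) := by
            refine Finset.sum_le_sum fun j _ => ?_
            have hcp := (hf (κ p)).continuous
            have hcq := (hf (κ q)).continuous
            have m1 : Measurable fun x => ENNReal.ofReal |f (κ p) x - c (κ p) j| :=
              ENNReal.measurable_ofReal.comp (Continuous.measurable (by fun_prop))
            rw [← lintegral_add_left m1, ← lintegral_add_right _ measurable_const]
            apply lintegral_mono fun x => ?_
            rw [← ENNReal.ofReal_add (by positivity) (by positivity),
              ← ENNReal.ofReal_add (by positivity) (by positivity)]
            apply ENNReal.ofReal_le_ofReal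
            have e : f (κ p) x - f (κ q) x = (f (κ p) x - c (κ p) j) +
              (-(f (κ q) x - c (κ q) j)) + (c (κ p) j - c (κ q) j) := by ring
            rw [e]
            refine (abs_add_three _ _ _).trans ?_
            rw [abs_neg]
            linarith [hcl j]
        _ ≤ ENNReal.ofReal (8 * M / n) + ENNReal.ofReal (8 * M / n) + ENNReal.ofReal (1 / n) := by
            rw [Finset.sum_add_distrib, Finset.sum_add_distrib, sum_Qn hn]
            refine add_le_add (add_le_add ((hc2 _).trans (hV _)) ((hc2 _).trans (hV _))) ?_
            simp
        _ = _ := by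
            rw [← ENNReal.ofReal_add (by positivity) (by positivity),
              ← ENNReal.ofReal_add (by positivity) (by positivity)]
            congr 1; ring
    rw [edist_dist, ENNReal.ofReal_le_ofReal_iff (by positivity)] at hd
    refine hd.trans_lt ?_
    rw [div_lt_iff₀ hδ] at hnδ
    rw [div_lt_iff₀ hn']; linarith
  have hcomp : IsCompact (closure (Set.range F)) := htb.closure.isCompact_of_isClosed isClosed_closure
  obtain ⟨p, -, φ, hφ, hlim⟩ := hcomp.tendsto_subseq (fun k => subset_closure (Set.mem_range_self k))
  refine ⟨φ, hφ, p, L1.integrable_coeFn p, ?_⟩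
  have h := tendsto_iff_norm_sub_tendsto_zero.1 hlim
  refine h.congr fun k => ?_
  rw [L1.norm_eq_integral_norm]
  apply integral_congr_ae
  filter_upwards [Lp.coeFn_sub (F (φ k)) p, (hIntg (φ k)).coeFn_toL1] with x hx hx2
  simp only [Function.comp]
  rw [hx, Pi.sub_apply, hx2, Real.norm_eq_abs]

lemma int_single_zero {ψ : R2 → ℝ} (hf : ContDiff ℝ 1 ψ) (hp : PerZ ψ) (i : Fin 2) :
    ∫ x in cube, fderiv ℝ ψ x (Pi.single i 1) = 0 := by
  have h := int_partial_zero hf hp (Pi.single i 1)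
  have e : (fun k => (((Pi.single i 1 : Fin 2 → ℤ) k : ℤ) : ℝ)) = (Pi.single i 1 : R2) := by
    funext k
    by_cases hk : k = i
    · subst hk; simp
    · simp [Pi.single_eq_of_ne hk]
  rwa [e] at h

lemma adm_comp {φ : R2 → R2} (hφ : IsAdmField φ) (i : Fin 2) : ContDiff ℝ 1 (fun x => φ x i) :=
  (contDiff_pi.1 hφ.1 i).of_le (by exact_mod_cast le_top)

lemma adm_contDiff {φ : R2 → R2} (hφ : IsAdmField φ) : ContDiff ℝ 1 φ :=
  contDiff_pi.2 (adm_comp hφ)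

lemma cont_div {φ : R2 → R2} (hφ : IsAdmField φ) :
    Continuous fun x => ∑ i, fderiv ℝ φ x (Pi.single i 1) i := by
  have hcf := (adm_contDiff hφ).continuous_fderiv one_ne_zero
  refine continuous_finsetSum _ fun j _ => ?_
  have h2 : Continuous fun x => fderiv ℝ φ x (Pi.single j 1) := by fun_prop
  exact (continuous_apply j).comp h2

lemma ibp {f : R2 → ℝ} (hf : ContDiff ℝ 1 f) (hp : PerZ f) {φ : R2 → R2} (hφ : IsAdmField φ) :
    ∫ x in cube, f x * ∑ i, fderiv ℝ φ x (Pi.single i 1) i ≤ ∫ x in cube, gradNorm f x := by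
  set ψ : Fin 2 → R2 → ℝ := fun i x => f x * φ x i with hψ
  have hψc : ∀ i, ContDiff ℝ 1 (ψ i) := fun i => hf.mul (adm_comp hφ i)
  have hψp : ∀ i, PerZ (ψ i) := by
    intro i x n
    simp only [hψ, hp x n, hφ.2.1 x n]
  have hd : ∀ i x, fderiv ℝ (ψ i) x (Pi.single i 1) =
      f x * fderiv ℝ φ x (Pi.single i 1) i + φ x i * fderiv ℝ f x (Pi.single i 1) := by
    intro i x
    have d1 := (hf.differentiable one_ne_zero x).hasFDerivAt
    have d2 := hasFDerivAt_pi'.1 ((adm_contDiff hφ).differentiable one_ne_zero x).hasFDerivAt i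
    have := (d1.mul d2).fderiv
    have e : ψ i = f * fun x => φ x i := rfl
    rw [e, this]
    simp
  have hcψ : ∀ i, Continuous fun x => fderiv ℝ (ψ i) x (Pi.single i 1) := by
    intro i
    have := (hψc i).continuous_fderiv one_ne_zero
    fun_prop
  have hpt : ∀ x, f x * ∑ i, fderiv ℝ φ x (Pi.single i 1) i ≤
      (fderiv ℝ (ψ 0) x (Pi.single 0 1) + fderiv ℝ (ψ 1) x (Pi.single 1 1)) + gradNorm f x := by
    intro x
    rw [hd, hd, Fin.sum_univ_two]
    have h1 := fderiv_abs_le f x (φ x)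
    have hz : φ x = ![φ x 0, φ x 1] := by ext i; fin_cases i <;> rfl
    have h2 : fderiv ℝ f x (φ x) =
        fderiv ℝ f x (Pi.single 0 1) * φ x 0 + fderiv ℝ f x (Pi.single 1 1) * φ x 1 := by
      conv_lhs => rw [hz]
      exact fderiv_pv _ _ _ _
    have h3 : en2 (φ x) * gradNorm f x ≤ 1 * gradNorm f x :=
      mul_le_mul_of_nonneg_right (hφ.2.2 x) (sqrt_nonneg _)
    have h4 := (abs_le.1 (h1.trans h3)).1
    rw [h2] at h4
    linarith
  have hcf := hf.continuous
  have hcd := cont_div hφ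
  have i0 := cont_int (hcψ 0)
  have i1 := cont_int (hcψ 1)
  have i01 : Integrable (fun x => fderiv ℝ (ψ 0) x (Pi.single 0 1) +
      fderiv ℝ (ψ 1) x (Pi.single 1 1)) (volume.restrict cube) := i0.add i1
  calc _ ≤ ∫ x in cube, ((fderiv ℝ (ψ 0) x (Pi.single 0 1) + fderiv ℝ (ψ 1) x (Pi.single 1 1))
          + gradNorm f x) :=
        integral_mono (cont_int (hcf.mul hcd))
          ((i0.add i1).add (cont_int (cont_gradNorm hf))) hpt
    _ = _ := by
        rw [integral_add i01 (cont_int (cont_gradNorm hf)), integral_add i0 i1,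
          int_single_zero (hψc 0) (hψp 0), int_single_zero (hψc 1) (hψp 1)]
        ring

lemma TV_lim {f : ℕ → R2 → ℝ} (hf : ∀ k, ContDiff ℝ 1 (f k)) (hp : ∀ k, PerZ (f k))
    {M : ℝ} (hM : ∀ k, ∫ x in cube, gradNorm (f k) x ≤ M) {g : R2 → ℝ}
    (hg : Integrable g (volume.restrict cube))
    (hlim : Tendsto (fun k => ∫ x in cube, |f k x - g x|) atTop (nhds 0)) :
    BddAbove (TVset g) := by
  refine ⟨M, ?_⟩
  rintro t ⟨φ, hφ, rfl⟩
  set d : R2 → ℝ := fun x => ∑ i, fderiv ℝ φ x (Pi.single i 1) i with hd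
  have hcd : Continuous d := cont_div hφ
  obtain ⟨B, hB⟩ := (isCompact_Icc (a := (0 : R2)) (b := 1)).exists_bound_of_continuousOn
    hcd.continuousOn
  have hBc : ∀ᵐ x ∂(volume.restrict cube), ‖d x‖ ≤ B := by
    filter_upwards [self_mem_ae_restrict meas_cube] with x hx
    exact hB x (cube_sub hx)
  have igd : Integrable (fun x => g x * d x) (volume.restrict cube) :=
    hg.mul_bdd hcd.aestronglyMeasurable hBc
  have ifg : ∀ k, Integrable (fun x => f k x - g x) (volume.restrict cube) := fun k =>
    (cont_int (hf k).continuous).sub hg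
  have ifd : ∀ k, Integrable (fun x => f k x * d x) (volume.restrict cube) := fun k =>
    cont_int ((hf k).continuous.mul hcd)
  have hle : ∀ k, ∫ x in cube, g x * d x ≤ M + B * ∫ x in cube, |f k x - g x| := by
    intro k
    have h1 := (ibp (hf k) (hp k) hφ).trans (hM k)
    have h2 : ∫ x in cube, g x * d x ≤ ∫ x in cube, (f k x * d x + B * |f k x - g x|) := by
      apply integral_mono_ae igd ((ifd k).add ((ifg k).abs.const_mul B))
      filter_upwards [hBc] with x hx
      have h3 : (g x - f k x) * d x ≤ B * |f k x - g x| := by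
        refine (le_abs_self _).trans ?_
        rw [abs_mul, abs_sub_comm, mul_comm]
        exact mul_le_mul_of_nonneg_right hx (abs_nonneg _)
      simp only [Pi.add_apply]
      linarith
    rw [integral_add (ifd k) ((ifg k).abs.const_mul B), integral_const_mul] at h2
    linarith
  have ht : Tendsto (fun k => M + B * ∫ x in cube, |f k x - g x|) atTop (nhds (M + B * 0)) :=
    (hlim.const_mul B).const_add M
  have := ge_of_tendsto' ht hle
  rw [mul_zero, add_zero] at this
  exact this

lemma mass_bound {ε E : ℝ} (hε : 0 < ε) {m : R2 → R3} (hm : Mag m)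
    (hE : ∫ x in cube, eloc ε m x ≤ E) : ∫ x in cube, (1 - (m x 2) ^ 2) ≤ 2 * ε * E := by
  have hc := (mag_contDiff hm 2).continuous
  calc _ ≤ ∫ x in cube, 2 * ε * eloc ε m x := by
        apply integral_mono (cont_int (by fun_prop)) ((cont_int (cont_eloc ε hm)).const_mul _)
        intro x
        have hP := gradVSq_nonneg m x
        simp only [eloc]
        have : 2 * ε * (ε / 2 * gradVSq m x + (1 - m x 2 ^ 2) / (2 * ε)) =
          ε ^ 2 * gradVSq m x + (1 - m x 2 ^ 2) := by field_simp
        rw [this]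
        have : 0 ≤ ε ^ 2 * gradVSq m x := by positivity
        linarith
    _ = 2 * ε * ∫ x in cube, eloc ε m x := integral_const_mul _ _
    _ ≤ _ := by gcongr

lemma en3_bound {m : R2 → R3} (hm : Mag m) (g s : ℝ) (hs : 0 < s) (x : R2) :
    en3 (m x - g • e3) ≤ |m x 2 - g| + (s + (1 - (m x 2) ^ 2) / s) := by
  have h2 := hm.2.2 x
  rw [Fin.sum_univ_three] at h2
  have hQ := one_sub_nonneg hm x
  unfold en3
  rw [Fin.sum_univ_three]
  simp only [Pi.sub_apply, Pi.smul_apply, e3, Matrix.cons_val_zero, Matrix.cons_val_one,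
    Matrix.cons_val, smul_eq_mul, mul_zero, sub_zero, mul_one]
  apply sqrt_le_iff.2
  refine ⟨by positivity, ?_⟩
  have h3 : m x 0 ^ 2 + m x 1 ^ 2 = 1 - m x 2 ^ 2 := by linarith
  rw [h3]
  set q := 1 - m x 2 ^ 2
  have h4 : q ≤ (s + q / s) ^ 2 := by
    have : (s + q / s) ^ 2 = s ^ 2 + 2 * q + (q / s) ^ 2 := by field_simp; ring
    rw [this]; nlinarith [sq_nonneg s, sq_nonneg (q / s)]
  have h5 : 0 ≤ s + q / s := by positivity
  have h6 := sq_abs (m x 2 - g)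
  nlinarith [mul_nonneg (abs_nonneg (m x 2 - g)) h5]

/-- Theorem `th:crit-F`, item (iv), compactness upon rescaling:
at the critical parameter `λ_c = π/2`, sequences with energy at most `C/|log ε_k|` are
`L¹`-precompact with `BV(𝕋²;{±e₃})` limits. -/
theorem stmt_18 (C : ℝ) (hC : 0 < C)
    (ε : ℕ → ℝ) (hε : ∀ k, 0 < ε k ∧ ε k < 1) (hε0 : Tendsto ε atTop (nhds 0))
    (m : ℕ → R2 → R3) (hm : ∀ k, Mag (m k))
    (hbd : ∀ k, Fen (ε k) (π / 2) (m k) ≤ C / |Real.log (ε k)|) :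
    ∃ φ : ℕ → ℕ, StrictMono φ ∧ ∃ mlim : R2 → R3, IsBVpm mlim ∧
      Tendsto (fun k => ∫ x in cube, en3 (m (φ k) x - mlim x)) atTop (nhds 0) := by
  have hmain : ∃ K, ∀ k, 3 ≤ -log (ε (k + K)) := by
    have h := (hε0.eventually (eventually_lt_nhds (exp_pos (-3)))).exists_forall_of_atTop
    obtain ⟨K, hK⟩ := h
    refine ⟨K, fun k => ?_⟩
    have h1 := hK (k + K) (by omega)
    have := log_lt_log (hε _).1 h1
    rw [log_exp] at this
    linarith
  obtain ⟨K, hK⟩ := hmain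
  set M := C + π * exp 3 with hM
  have hEb : ∀ k, ∫ x in cube, eloc (ε (k + K)) (m (k + K)) x ≤ M := fun k =>
    energy_bound (hε _).1 (hK k) (hm _) (hbd _)
  set f : ℕ → R2 → ℝ := fun k x => m (k + K) x 2 with hf
  have hfc : ∀ k, ContDiff ℝ 1 (f k) := fun k => mag_contDiff (hm _) 2
  have hfp : ∀ k, PerZ (f k) := fun k => mag_per (hm _) 2
  have hV : ∀ k, ∫ x in cube, gradNorm (f k) x ≤ M := fun k =>
    (integral_mono (cont_int (cont_gradNorm (hfc k))) (cont_int (cont_eloc _ (hm _)))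
      (gradNorm_le_eloc (hε _).1 (hm _))).trans (hEb k)
  obtain ⟨φ, hφ, g, hg, hlim⟩ := compact_BV hfc hfp (fun k x => mag_abs (hm _) x) hV
  have hφK : Tendsto (fun k => φ k + K) atTop atTop :=
    tendsto_atTop_mono (fun k => Nat.le_add_right _ _) hφ.tendsto_atTop
  have hε1 : Tendsto (fun k => ε (φ k + K)) atTop (nhds 0) := hε0.comp hφK
  have hmass : ∀ k, ∫ x in cube, (1 - (f (φ k) x) ^ 2) ≤ 2 * ε (φ k + K) * M := fun k =>
    mass_bound (hε _).1 (hm _) (hEb _)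
  have hcQ : ∀ k, Continuous fun x => 1 - (f (φ k) x) ^ 2 := fun k => by
    have := (hfc (φ k)).continuous
    fun_prop
  have ifg : ∀ k, Integrable (fun x => |f (φ k) x - g x|) (volume.restrict cube) := fun k =>
    ((cont_int (hfc (φ k)).continuous).sub hg).abs
  -- the limit has modulus one
  have hone : ∀ᵐ x ∂(volume.restrict cube), |g x| = 1 := by
    have ig1 : Integrable (fun x => |(|g x| - 1)|) (volume.restrict cube) :=
      (hg.abs.sub (integrable_const 1)).abs
    have hle : ∀ k, ∫ x in cube, |(|g x| - 1)| ≤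
        (∫ x in cube, |f (φ k) x - g x|) + 2 * ε (φ k + K) * M := by
      intro k
      calc _ ≤ ∫ x in cube, (|f (φ k) x - g x| + (1 - (f (φ k) x) ^ 2)) := by
            apply integral_mono ig1
              ((ifg k).add (cont_int (hcQ k)))
            intro x
            simp only [Pi.add_apply]
            have h1 : |f (φ k) x| ≤ 1 := mag_abs (hm _) x
            have h2 := abs_abs_sub_abs_le_abs_sub (f (φ k) x) (g x)
            have h3 := abs_le.1 h2
            have h4 := sq_abs (f (φ k) x)
            have h5 := abs_nonneg (f (φ k) x)
            have h6 : |f (φ k) x| ^ 2 ≤ |f (φ k) x| := by nlinarith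
            rw [abs_le]
            constructor <;> linarith
        _ = (∫ x in cube, |f (φ k) x - g x|) + ∫ x in cube, (1 - (f (φ k) x) ^ 2) :=
            integral_add (ifg k) (cont_int (hcQ k))
        _ ≤ _ := by linarith [hmass k]
    have ht : Tendsto (fun k => (∫ x in cube, |f (φ k) x - g x|) + 2 * ε (φ k + K) * M) atTop
        (nhds (0 + 2 * 0 * M)) := hlim.add ((hε1.const_mul 2).mul_const M)
    have h0 := ge_of_tendsto' ht hle
    have h1 : ∫ x in cube, |(|g x| - 1)| = 0 :=
      le_antisymm (by simpa using h0) (integral_nonneg fun x => abs_nonneg _)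
    rw [integral_eq_zero_iff_of_nonneg (fun x => abs_nonneg _)
      ig1] at h1
    filter_upwards [h1] with x hx
    have := abs_eq_zero.1 hx
    linarith
  refine ⟨fun k => φ k + K, fun a b hab => by simpa using hφ hab, fun x => g x • e3, ⟨?_, ?_⟩, ?_⟩
  · filter_upwards [hone] with x hx
    rcases (abs_eq zero_le_one).1 hx with h | h <;> simp [h]
  · have e : (fun x => (g x • e3) 2) = g := by
      funext x; simp [e3]
    rw [e]
    exact TV_lim (fun k => hfc (φ k)) (fun k => hfp (φ k)) (fun k => hV (φ k)) hg hlim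
  · set s : ℕ → ℝ := fun k => sqrt (ε (φ k + K)) with hs
    have hs0 : ∀ k, 0 < s k := fun k => sqrt_pos.2 (hε _).1
    have hst : Tendsto s atTop (nhds 0) := by
      have := hε1.sqrt
      simpa using this
    have hle : ∀ k, ∫ x in cube, en3 (m (φ k + K) x - g x • e3) ≤
        (∫ x in cube, |f (φ k) x - g x|) + (s k + 2 * s k * M) := by
      intro k
      have iq := (cont_int (hcQ k)).div_const (s k)
      have ic : Integrable (fun x => s k + (1 - (f (φ k) x) ^ 2) / s k) (volume.restrict cube) :=
        (integrable_const (s k)).add iq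
      calc _ ≤ ∫ x in cube, (|f (φ k) x - g x| + (s k + (1 - (f (φ k) x) ^ 2) / s k)) := by
            apply integral_mono_of_nonneg (Eventually.of_forall fun x => sqrt_nonneg _)
              ((ifg k).add ic)
            exact Eventually.of_forall fun x => en3_bound (hm _) (g x) (s k) (hs0 k) x
        _ = (∫ x in cube, |f (φ k) x - g x|) +
              (s k + (∫ x in cube, (1 - (f (φ k) x) ^ 2)) / s k) := by
            rw [integral_add (ifg k) ic, integral_add (integrable_const (s k)) iq, integral_div]
            simp
        _ ≤ _ := by
            gcongr
            rw [div_le_iff₀ (hs0 k)]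
            refine (hmass k).trans (le_of_eq ?_)
            have : ε (φ k + K) = s k * s k := (mul_self_sqrt (hε _).1.le).symm
            rw [this]; ring
    have ht : Tendsto (fun k => (∫ x in cube, |f (φ k) x - g x|) + (s k + 2 * s k * M)) atTop
        (nhds (0 + (0 + 2 * 0 * M))) := hlim.add (hst.add ((hst.const_mul 2).mul_const M))
    exact squeeze_zero (fun k => integral_nonneg fun x => sqrt_nonneg _) hle (by simpa using ht)
end
end
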